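/- Let i ∈ I be a player, let 𝒟^i be a partition of the set of states S that satisfies Property P' with respect to player i, and let c^i ∈ ℝ^{𝒟^i} satisfy c^i(D) ≥ overline-v^i_1(s) for every element D ∈ 𝒟^i and every state s ∈ D. Then for every initial state s₀ ∈ S, lim_{λ→1} overline-v̂^i_{λ,stat}(s₀;𝒟^i,c^i) = lim_{λ→1} overline-v̂^i_λ(s₀;𝒟^i,c^i), both limits existing (and equal to overline-v^i_1(s₀)). -/

import Mathlib

open MeasureTheory Filter Topology
open scoped ENNReal

noncomputable section

/-- A finite stochastic game: a finite set of players `I`, a finite set of states `S`,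
finite nonempty action sets `A i s`, stage payoffs `u` bounded by `1` in absolute value,
and transition probabilities `q`. -/
structure StocGame where
  (I : Type)
  (S : Type)
  (A : I → S → Type)
  [fintypeI : Fintype I]
  [fintypeS : Fintype S]
  [decI : DecidableEq I]
  [decS : DecidableEq S]
  [fintypeA : ∀ i s, Fintype (A i s)]
  [decA : ∀ i s, DecidableEq (A i s)]
  [nonemptyA : ∀ i s, Nonempty (A i s)]
  (u : I → (s : S) → ((j : I) → A j s) → ℝ)
  (u_bdd : ∀ i s a, |u i s a| ≤ 1)
  (q : (s : S) → ((j : I) → A j s) → S → ℝ)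
  (q_nonneg : ∀ s a s', 0 ≤ q s a s')
  (q_sum : ∀ s a, ∑ s', q s a s' = 1)

namespace StocGame

attribute [instance] fintypeI fintypeS decI decS fintypeA decA nonemptyA

/-- A mixed action over a finite set of actions. -/
abbrev Mixed (α : Type) [Fintype α] : Type := {f : α → ℝ // (∀ a, 0 ≤ f a) ∧ ∑ a, f a = 1}

variable {G : StocGame}

/-- Action profiles available at state `s`. -/
abbrev Prof (G : StocGame) (s : G.S) : Type := (j : G.I) → G.A j s

/-- A pair of a state together with an action profile at that state. -/
abbrev Step (G : StocGame) : Type := Σ s : G.S, G.Prof s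

/-- A finite history: a (reversed) list of past (state, action profile) steps,
together with the current state. -/
abbrev Hist (G : StocGame) : Type := List G.Step × G.S

/-- A behavior strategy of player `i`. -/
abbrev BStrat (G : StocGame) (i : G.I) : Type := (h : G.Hist) → Mixed (G.A i h.2)

/-- A (behavior) strategy profile. -/
abbrev Profile (G : StocGame) : Type := (i : G.I) → G.BStrat i

/-- A stationary strategy of player `i`. -/
abbrev Stat (G : StocGame) (i : G.I) : Type := (s : G.S) → Mixed (G.A i s)

/-- A stationary strategy profile. -/
abbrev StatProf (G : StocGame) : Type := (i : G.I) → G.Stat i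

/-- The behavior strategy profile induced by a stationary strategy profile. -/
def toB (x : G.StatProf) : G.Profile := fun i h => x i h.2

/-- The behavior strategy induced by a stationary strategy. -/
def toB1 {i : G.I} (x : G.Stat i) : G.BStrat i := fun h => x h.2

/-- A stationary strategy profile is pure if at every state each player
puts probability `1` on a single action. -/
def IsPureStat (x : G.StatProf) : Prop :=
  ∀ (i : G.I) (s : G.S), ∃ a : G.A i s, ∀ b, (x i s).1 b = if b = a then 1 else 0

/-- The probability, under strategy profile `σ` and initial state `s0`, that the play follows
the finite history whose (reversed) list of steps is the first argument and whose current
state is the second argument. -/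
def probHistAux (s0 : G.S) (σ : G.Profile) : List G.Step → G.S → ℝ
  | [], s => if s = s0 then 1 else 0
  | ⟨s', a⟩ :: rest, s =>
      probHistAux s0 σ rest s' * (∏ i, (σ i (rest, s')).1 (a i)) * G.q s' a s

/-- The probability that the play follows the finite history `h`. -/
def probHist (s0 : G.S) (σ : G.Profile) (h : G.Hist) : ℝ := probHistAux s0 σ h.1 h.2

/-- The expected `lam`-discounted time `t_lam(s0,σ;s,a)` that the play spends at the
state-action pair `st = (s,a)`. -/
def tStep (lam : ℝ) (s0 : G.S) (σ : G.Profile) (st : G.Step) : ℝ :=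
  (1 - lam) *
    ∑' h : G.Hist, (if h.1.head? = some st then lam ^ (h.1.length - 1) * probHist s0 σ h else 0)

/-- The expected `lam`-discounted time that the play spends in the set of states `D`. -/
def tSet (lam : ℝ) (s0 : G.S) (σ : G.Profile) (D : Finset G.S) : ℝ :=
  ∑ st : G.Step, if st.1 ∈ D then tStep lam s0 σ st else 0

/-- The `lam`-discounted (unnormalized) payoff `U^i_lam(s0,σ;D)` that player `i` receives
while the play is in `D`. -/
def UD (lam : ℝ) (s0 : G.S) (σ : G.Profile) (i : G.I) (D : Finset G.S) : ℝ :=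
  ∑ st : G.Step, if st.1 ∈ D then tStep lam s0 σ st * G.u i st.1 st.2 else 0

/-- The `lam`-discounted payoff of player `i`. -/
def payoffD (lam : ℝ) (s0 : G.S) (σ : G.Profile) (i : G.I) : ℝ :=
  ∑ st : G.Step, tStep lam s0 σ st * G.u i st.1 st.2

/-- `Di` is a partition of the set of states. -/
def IsPartitionF (Di : Finset (Finset G.S)) : Prop :=
  ∀ s : G.S, ∃! D : Finset G.S, D ∈ Di ∧ s ∈ D

/-- The payoff of player `i` in the modified game, given the partition `Di` and
the cutoffs `c`. -/
def modPayoff (lam : ℝ) (s0 : G.S) (σ : G.Profile) (i : G.I)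
    (Di : Finset (Finset G.S)) (c : Finset G.S → ℝ) : ℝ :=
  ∑ D ∈ Di, min (UD lam s0 σ i D) (tSet lam s0 σ D * c D)

/-- The `lam`-discounted min-max value of player `i` in the original game. -/
def minmaxOrig (G : StocGame) (lam : ℝ) (s0 : G.S) (i : G.I) : ℝ :=
  ⨅ σ : G.Profile, ⨆ σi : G.BStrat i, payoffD lam s0 (Function.update σ i σi) i

/-- The `lam`-discounted max-min value of player `i` in the original game. -/
def maxminOrig (G : StocGame) (lam : ℝ) (s0 : G.S) (i : G.I) : ℝ :=
  ⨆ σi : G.BStrat i, ⨅ σ : G.Profile, payoffD lam s0 (Function.update σ i σi) i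

/-- The min-max value of player `i` in the modified game. -/
def minmaxMod (G : StocGame) (lam : ℝ) (s0 : G.S) (i : G.I)
    (Di : Finset (Finset G.S)) (c : Finset G.S → ℝ) : ℝ :=
  ⨅ σ : G.Profile, ⨆ σi : G.BStrat i,
    modPayoff lam s0 (Function.update σ i σi) i Di c

/-- The max-min value of player `i` in the modified game. -/
def maxminMod (G : StocGame) (lam : ℝ) (s0 : G.S) (i : G.I)
    (Di : Finset (Finset G.S)) (c : Finset G.S → ℝ) : ℝ :=
  ⨆ σi : G.BStrat i, ⨅ σ : G.Profile,
    modPayoff lam s0 (Function.update σ i σi) i Di c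

/-- The min-max value in stationary strategies of player `i` in the modified game. -/
def minmaxModStat (G : StocGame) (lam : ℝ) (s0 : G.S) (i : G.I)
    (Di : Finset (Finset G.S)) (c : Finset G.S → ℝ) : ℝ :=
  ⨅ x : G.StatProf, ⨆ xi : G.Stat i,
    modPayoff lam s0 (Function.update (toB x) i (toB1 xi)) i Di c

/-- The max-min value in stationary strategies of player `i` in the modified game. -/
def maxminModStat (G : StocGame) (lam : ℝ) (s0 : G.S) (i : G.I)
    (Di : Finset (Finset G.S)) (c : Finset G.S → ℝ) : ℝ :=
  ⨆ xi : G.Stat i, ⨅ x : G.StatProf,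
    modPayoff lam s0 (Function.update (toB x) i (toB1 xi)) i Di c

/-! ### Plays and the induced measure -/

/-- A play: the infinite sequence of (state, action profile) pairs. -/
abbrev Play (G : StocGame) : Type := ℕ → G.Step

instance : MeasurableSpace G.Step := ⊤

/-- The finite history consisting of the first `n` stages of the play `p`
(reversed list of the first `n` steps, together with the state at stage `n`). -/
def histOf (p : G.Play) : ℕ → G.Hist
  | 0 => ([], (p 0).1)
  | n + 1 => ((p n) :: (histOf p n).1, (p (n + 1)).1)

/-- The cylinder set of plays whose initial segment is the finite history `h`. -/
def cylSet (h : G.Hist) : Set G.Play := {p | histOf p h.1.length = h}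

/-- `μfam` is the family of probability measures on plays induced (via the
Ionescu–Tulcea theorem) by the initial state and the strategy profile:
it is characterized by being a probability measure giving each cylinder set
the probability of the corresponding finite history. -/
def IsInduced (μfam : G.S → G.Profile → Measure G.Play) : Prop :=
  (∀ s0 σ, IsProbabilityMeasure (μfam s0 σ)) ∧
  ∀ (s0 : G.S) (σ : G.Profile) (h : G.Hist),
    μfam s0 σ (cylSet h) = ENNReal.ofReal (probHist s0 σ h)

/-- A bounded stopping time (with respect to the filtration generated by finite histories). -/
def IsBddST (τ : G.Play → ℕ) : Prop :=
  (∃ B, ∀ p, τ p ≤ B) ∧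
  ∀ p p' n, τ p = n → histOf p n = histOf p' n → τ p' = n

/-- Two states lie in the same element of the partition `Di`. -/
def sameOf (Di : Finset (Finset G.S)) (s s' : G.S) : Prop := ∃ D ∈ Di, s ∈ D ∧ s' ∈ D

open Classical in
/-- The number of switches between elements of a partition along a play,
where the partition is described through the relation `r` ("being in the same element"). -/
def Zsw (r : G.S → G.S → Prop) (p : G.Play) : ℝ≥0∞ :=
  ∑' n : ℕ, if r (p n).1 (p (n + 1)).1 then 0 else 1

/-- The stopping times `τ^𝒟_k` indicating when the play moves from one element of
the partition (described by the relation `r`) to another. -/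
def switchT (r : G.S → G.S → Prop) (p : G.Play) : ℕ → ℕ∞
  | 0 => 0
  | k + 1 => sInf {n : ℕ∞ | ∃ m : ℕ, n = (m : ℕ∞) ∧ switchT r p k < (m : ℕ∞) ∧
      ¬ r (p (m - 1)).1 (p m).1}

/-- The expected average payoff of player `i` in the `N`-stage game. -/
def payoffN (μfam : G.S → G.Profile → Measure G.Play) (N : ℕ) (s0 : G.S)
    (σ : G.Profile) (i : G.I) : ℝ :=
  (∫ p, (∑ n ∈ Finset.range N, G.u i (p n).1 (p n).2) ∂(μfam s0 σ)) / N

/-- `σi` is a uniform `ε`-max-min strategy of player `i` (with respect to the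
uniform max-min value function `v`). -/
def UnifMaxMin (μfam : G.S → G.Profile → Measure G.Play) (v : G.S → ℝ) (i : G.I)
    (σi : G.BStrat i) (ε : ℝ) : Prop :=
  ∃ lam0 : ℝ, 0 ≤ lam0 ∧ lam0 < 1 ∧ ∃ N0 : ℕ,
    ∀ (s0 : G.S) (σ : G.Profile),
      (∀ lam : ℝ, lam0 < lam → lam < 1 →
        v s0 - ε ≤ payoffD lam s0 (Function.update σ i σi) i) ∧
      (∀ τ : G.Play → ℕ, IsBddST τ →
        (N0 : ℝ) ≤ ∫ p, (τ p : ℝ) ∂(μfam s0 (Function.update σ i σi)) →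
        (v s0 - ε) * ∫ p, (τ p : ℝ) ∂(μfam s0 (Function.update σ i σi)) ≤
          ∫ p, (∑ n ∈ Finset.range (τ p), G.u i (p n).1 (p n).2)
            ∂(μfam s0 (Function.update σ i σi)))

/-- `σi` is `(𝒟,ε)`-max-min preserving, where the partition `𝒟` is described by the
relation `r`, and the conditional-expectation requirement is expressed through
integrals over the atoms (cylinder sets) of the σ-algebra of the stopping time `τ^𝒟_k`. -/
def PreservingPart (μfam : G.S → G.Profile → Measure G.Play) (v : G.S → ℝ)
    (r : G.S → G.S → Prop) (i : G.I) (σi : G.BStrat i) (ε : ℝ) : Prop :=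
  ∀ (s0 : G.S) (σ : G.Profile) (k : ℕ) (τ' : G.Play → ℕ), IsBddST τ' →
    (∀ p, switchT r p k ≠ ⊤ →
      switchT r p k < (τ' p : ℕ∞) ∧ (τ' p : ℕ∞) ≤ switchT r p (k + 1)) →
    ∀ h : G.Hist, (∀ p ∈ cylSet h, switchT r p k = (h.1.length : ℕ∞)) →
      ∫ p in cylSet h, (v h.2 - ε) ∂(μfam s0 (Function.update σ i σi)) ≤
        ∫ p in cylSet h, v ((p (τ' p)).1) ∂(μfam s0 (Function.update σ i σi))

/-- `σi` is `ε`-max-min preserving (with respect to arbitrary bounded stopping times);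
again the conditional-expectation requirement is expressed through integrals over the
atoms of the σ-algebra of the stopping time `τ`. -/
def PreservingST (μfam : G.S → G.Profile → Measure G.Play) (v : G.S → ℝ) (i : G.I)
    (σi : G.BStrat i) (ε : ℝ) : Prop :=
  ∀ (s0 : G.S) (σ : G.Profile) (τ τ' : G.Play → ℕ), IsBddST τ → IsBddST τ' →
    (∀ p, τ p < τ' p) →
    ∀ h : G.Hist, (∀ p ∈ cylSet h, τ p = h.1.length) →
      ∫ p in cylSet h, (v h.2 - ε) ∂(μfam s0 (Function.update σ i σi)) ≤
        ∫ p in cylSet h, v ((p (τ' p)).1) ∂(μfam s0 (Function.update σ i σi))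

/-- A history enters a new element of the partition (described by `r`) at its final stage. -/
def entersNew (r : G.S → G.S → Prop) (h : G.Hist) : Prop :=
  match h.1 with
  | [] => True
  | st :: _ => ¬ r st.1 h.2

/-- `σi` is `𝒟`-Markovian: its continuation strategy coincides after any two finite histories
that end at the same state and whose final stage enters a new element of the partition
(described by `r`). -/
def Markovian (r : G.S → G.S → Prop) {i : G.I} (σi : G.BStrat i) : Prop :=
  ∀ h h' : G.Hist, h.2 = h'.2 → entersNew r h → entersNew r h' →
    ∀ (l : List G.Step) (s'' : G.S), σi (l ++ h.1, s'') = σi (l ++ h'.1, s'')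

open Classical in
/-- The portion of the history since the last time the play entered a new element of the
partition (described by `r`): (reversed) list of steps, given the current state. -/
def philist (r : G.S → G.S → Prop) : List G.Step → G.S → List G.Step
  | [], _ => []
  | st :: rest, s => if r st.1 s then st :: philist r rest st.1 else []

/-- The restart strategy `σ^i_𝒟`: whenever the play enters a new element of the partition
(described by `r`), player `i` forgets past play and restarts playing `σi`. -/
def restart {i : G.I} (σi : G.BStrat i) (r : G.S → G.S → Prop) : G.BStrat i :=
  fun h => σi (philist r h.1 h.2, h.2)

/-- The partition `Di` satisfies Property P with respect to player `i`
(whose uniform max-min value function is `v`). -/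
def PropertyP (μfam : G.S → G.Profile → Measure G.Play) (v : G.S → ℝ) (i : G.I)
    (Di : Finset (Finset G.S)) : Prop :=
  ∃ ζ : ℝ, 0 < ζ ∧ ∀ ε : ℝ, 0 < ε → ∃ σi : G.BStrat i,
    Markovian (sameOf Di) σi ∧ UnifMaxMin μfam v i σi ε ∧
    ∀ (s0 : G.S) (σ : G.Profile), ∃ E : Set G.Play,
      ENNReal.ofReal (1 - ε) < μfam s0 (Function.update σ i σi) E ∧
      ∫⁻ p in E, Zsw (sameOf Di) p ∂(μfam s0 (Function.update σ i σi)) ≤ ENNReal.ofReal ζ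

/-- The strategy profile `σ` (whose `i`-th coordinate is the strategy of player `i`) makes
player `i`'s strategy a uniform `𝒟`-subgame-perfect `ε`-min-max strategy against the others'
strategies, at the initial state `s0`; `vbar` is the uniform min-max value function of
player `i`, and the partition `𝒟` is described by the relation `r`.  Conditional-expectation
requirements are expressed through integrals over the atoms (cylinder sets) of the σ-algebra
of the stopping time `τ^𝒟_k`. -/
def SubgamePerfect (μfam : G.S → G.Profile → Measure G.Play) (vbar : G.S → ℝ)
    (r : G.S → G.S → Prop) (i : G.I) (σ : G.Profile) (s0 : G.S) (ε : ℝ) : Prop :=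
  ∃ N0 : ℕ, 0 < N0 ∧
    (∀ N : ℕ, N0 ≤ N → vbar s0 - ε ≤ payoffN μfam N s0 σ i) ∧
    (∀ (k : ℕ) (τ : G.Play → ℕ), IsBddST τ → (∀ p, switchT r p k ≤ (τ p : ℕ∞)) →
      ∀ h : G.Hist, (∀ p ∈ cylSet h, switchT r p k = (h.1.length : ℕ∞)) →
        (∫ p in cylSet h, (vbar h.2 - ε) ∂(μfam s0 σ) ≤
          ∫ p in cylSet h, vbar ((p (τ p)).1) ∂(μfam s0 σ)) ∧
        ((N0 : ℝ) * (μfam s0 σ (cylSet h)).toReal ≤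
            ∫ p in cylSet h, ((τ p : ℝ) - (h.1.length : ℝ)) ∂(μfam s0 σ) →
          (vbar h.2 - ε) * ∫ p in cylSet h, ((τ p : ℝ) - (h.1.length : ℝ)) ∂(μfam s0 σ) ≤
            ∫ p in cylSet h, (∑ n ∈ Finset.Ico h.1.length (τ p), G.u i (p n).1 (p n).2)
              ∂(μfam s0 σ)))

/-- The partition `Di` satisfies Property P' with respect to player `i`
(whose uniform min-max value function is `vbar`). -/
def PropertyP' (μfam : G.S → G.Profile → Measure G.Play) (vbar : G.S → ℝ) (i : G.I)
    (Di : Finset (Finset G.S)) : Prop :=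
  ∃ ζ : ℝ, 0 < ζ ∧ ∀ ε : ℝ, 0 < ε → ∀ (s0 : G.S) (σ : G.Profile), ∃ σi : G.BStrat i,
    SubgamePerfect μfam vbar (sameOf Di) i (Function.update σ i σi) s0 ε ∧
    ∃ E : Set G.Play,
      ENNReal.ofReal (1 - ε) ≤ μfam s0 (Function.update σ i σi) E ∧
      ∫⁻ p in E, Zsw (sameOf Di) p ∂(μfam s0 (Function.update σ i σi)) ≤ ENNReal.ofReal ζ

/-! ### Reachability, closed and strongly controllable sets -/

/-- The first arrival time to the set of states `C`. -/
def hitT (C : Set G.S) (p : G.Play) : ℕ∞ :=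
  sInf {n : ℕ∞ | ∃ m : ℕ, n = (m : ℕ∞) ∧ (p m).1 ∈ C}

/-- State `s` leads in `D` to state `s'`. -/
def LeadsIn (μfam : G.S → G.Profile → Measure G.Play) (D : Set G.S) (s s' : G.S) : Prop :=
  ∃ σ : G.Profile, μfam s σ {p | hitT {s'} p < hitT Dᶜ p} = 1

/-- The states `s` and `s'` are `D`-siblings. -/
def Siblings (μfam : G.S → G.Profile → Measure G.Play) (D : Set G.S) (s s' : G.S) : Prop :=
  LeadsIn μfam D s s' ∧ LeadsIn μfam D s' s

/-- The probability `q(D | s, a)` that the next state lies in `D`. -/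
def qOf (D : Set G.S) (s : G.S) (a : G.Prof s) : ℝ := ∑ s', D.indicator (G.q s a) s'

/-- The set of states `D` is closed. -/
def ClosedSet (G : StocGame) (D : Set G.S) : Prop :=
  ∀ s ∈ D, ∀ a : G.Prof s, qOf D s a = 1

/-- The set of states `D` is strongly controllable. -/
def StronglyContr (G : StocGame) (D : Set G.S) : Prop :=
  ∃ iD : G.I, ∃ sD ∈ D, ∃ atil : G.A iD sD,
    ∀ s ∈ D, ∀ a : G.Prof s, qOf D s a < 1 → s = sD ∧ HEq (a iD) atil

/-- The element of the partition `𝒟` (by the vector of uniform min-max values `v`)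
that contains the state `s`. -/
def Dv (v : G.I → G.S → ℝ) (s : G.S) : Set G.S := {s' | ∀ i, v i s' = v i s}

/-- The element of the refined partition `𝒟*` (refining `𝒟` by the `D`-siblings relation)
that contains the state `s`. -/
def DstarCl (μfam : G.S → G.Profile → Measure G.Play) (v : G.I → G.S → ℝ) (s : G.S) :
    Set G.S := {s' | s' ∈ Dv v s ∧ Siblings μfam (Dv v s) s s'}

/-- The stochastic game is strongly controllable: every element of `𝒟*` is either closed
or strongly controllable. -/
def StronglyControllableGame (G : StocGame) (μfam : G.S → G.Profile → Measure G.Play)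
    (v : G.I → G.S → ℝ) : Prop :=
  ∀ s : G.S, ClosedSet G (DstarCl μfam v s) ∨ StronglyContr G (DstarCl μfam v s)

end StocGame

/-- A set `X ⊆ ℝ^ι` is monovex if every two points of `X` are connected by a continuous
path inside `X` all of whose coordinates are monotone. -/
def Monovex {ι : Type} (X : Set (ι → ℝ)) : Prop :=
  ∀ x ∈ X, ∀ y ∈ X, ∃ f : ℝ → ι → ℝ,
    ContinuousOn f (Set.Icc 0 1) ∧ (∀ t ∈ Set.Icc (0 : ℝ) 1, f t ∈ X) ∧
    f 0 = x ∧ f 1 = y ∧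
    ∀ j : ι, MonotoneOn (fun t => f t j) (Set.Icc 0 1) ∨
      AntitoneOn (fun t => f t j) (Set.Icc 0 1)

end

noncomputable section

namespace StocGame

variable {G : StocGame}

/-! ### Expectations over finite histories -/

/-- The history obtained from `h` when the profile `a` is played and the next state is `s`. -/
def snoc (h : G.Hist) (a : G.Prof h.2) (s : G.S) : G.Hist := (⟨h.2, a⟩ :: h.1, s)

/-- The probability that the profile `a` is played at the history `h`. -/
def profProb (σ : G.Profile) (h : G.Hist) (a : G.Prof h.2) : ℝ := ∏ j, (σ j h).1 (a j)

/-- The conditional expectation of `φ` one stage after the history `h`. -/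
def nextE (σ : G.Profile) (φ : G.Hist → ℝ) (h : G.Hist) : ℝ :=
  ∑ a, profProb σ h a * ∑ s, G.q h.2 a s * φ (snoc h a s)

/-- The expected value of `g` at the step played at the history `h`. -/
def stepE (σ : G.Profile) (g : G.Step → ℝ) (h : G.Hist) : ℝ :=
  ∑ a, profProb σ h a * g ⟨h.2, a⟩

/-- The histories of length `n`. -/
def histN (G : StocGame) : ℕ → Finset G.Hist
  | 0 => Finset.univ.map ⟨fun s => ([], s), fun _ _ h => (Prod.mk.inj h).2⟩
  | n + 1 => ((histN G n).sigma fun h => (Finset.univ : Finset (G.Prof h.2 × G.S))).map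
      ⟨fun x => snoc x.1 x.2.1 x.2.2, by
        rintro ⟨⟨l, s⟩, a, t⟩ ⟨⟨l', s'⟩, a', t'⟩ h
        simp only [snoc, Prod.mk.injEq, List.cons.injEq, Sigma.mk.injEq] at h
        obtain ⟨⟨⟨rfl, h2⟩, rfl⟩, rfl⟩ := h
        obtain rfl := eq_of_heq h2
        rfl⟩

/-- The expected value of `φ` at the history of length `n`. -/
def histE (s0 : G.S) (σ : G.Profile) (n : ℕ) (φ : G.Hist → ℝ) : ℝ :=
  ∑ h ∈ histN G n, probHist s0 σ h * φ h

theorem mem_histN {n : ℕ} {h : G.Hist} : h ∈ histN G n ↔ h.1.length = n := by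
  induction n generalizing h with
  | zero =>
    obtain ⟨l, s⟩ := h
    simp only [histN, Finset.mem_map, Finset.mem_univ, true_and, List.length_eq_zero_iff]
    constructor
    · rintro ⟨t, ht⟩
      exact (Prod.mk.inj ht).1.symm
    · rintro rfl
      exact ⟨s, rfl⟩
  | succ n ih =>
    obtain ⟨l, s⟩ := h
    simp only [histN, Finset.mem_map, Finset.mem_sigma, Finset.mem_univ, and_true]
    constructor
    · rintro ⟨⟨h', a, t⟩, hm, he⟩
      change snoc h' a t = (l, s) at he
      obtain rfl := (Prod.mk.inj he).1
      simpa using ih.1 hm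
    · intro hl
      match l, hl with
      | ⟨s', a⟩ :: rest, hl =>
        exact ⟨⟨(rest, s'), a, s⟩, ih.2 (by simpa using hl), rfl⟩

theorem profProb_nonneg (σ : G.Profile) (h : G.Hist) (a : G.Prof h.2) : 0 ≤ profProb σ h a :=
  Finset.prod_nonneg fun j _ => (σ j h).2.1 _

theorem sum_prod_mixed {s : G.S} (x : ∀ j, Mixed (G.A j s)) :
    ∑ a : G.Prof s, ∏ j, (x j).1 (a j) = 1 := by
  rw [← Fintype.prod_sum (fun j b => (x j).1 b)]
  exact Finset.prod_eq_one fun j _ => (x j).2.2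

theorem sum_profProb (σ : G.Profile) (h : G.Hist) : ∑ a, profProb σ h a = 1 :=
  sum_prod_mixed fun j => σ j h

theorem probHist_snoc (s0 : G.S) (σ : G.Profile) (h : G.Hist) (a : G.Prof h.2) (s : G.S) :
    probHist s0 σ (snoc h a s) = probHist s0 σ h * profProb σ h a * G.q h.2 a s := rfl

theorem probHist_nonneg (s0 : G.S) (σ : G.Profile) (h : G.Hist) : 0 ≤ probHist s0 σ h := by
  obtain ⟨l, s⟩ := h
  induction l generalizing s with
  | nil =>
    simp only [probHist, probHistAux]
    split_ifs <;> norm_num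
  | cons st rest ih =>
    exact mul_nonneg (mul_nonneg (ih st.1) (profProb_nonneg σ (rest, st.1) st.2))
      (G.q_nonneg _ _ _)

theorem sum_histN_zero (f : G.Hist → ℝ) : ∑ h ∈ histN G 0, f h = ∑ s, f ([], s) := by
  rw [histN, Finset.sum_map]
  rfl

theorem sum_histN_succ (n : ℕ) (f : G.Hist → ℝ) :
    ∑ h ∈ histN G (n + 1), f h = ∑ h ∈ histN G n, ∑ a, ∑ s, f (snoc h a s) := by
  rw [histN, Finset.sum_map, Finset.sum_sigma]
  exact Finset.sum_congr rfl fun h _ => Fintype.sum_prod_type _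

theorem histE_zero (s0 : G.S) (σ : G.Profile) (φ : G.Hist → ℝ) :
    histE s0 σ 0 φ = φ ([], s0) := by
  rw [histE, sum_histN_zero]
  simp [probHist, probHistAux]

theorem histE_succ (s0 : G.S) (σ : G.Profile) (n : ℕ) (φ : G.Hist → ℝ) :
    histE s0 σ (n + 1) φ = histE s0 σ n (nextE σ φ) := by
  simp only [histE, sum_histN_succ, probHist_snoc]
  refine Finset.sum_congr rfl fun h _ => ?_
  rw [nextE, Finset.mul_sum]
  refine Finset.sum_congr rfl fun a _ => ?_
  rw [Finset.mul_sum, Finset.mul_sum]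
  exact Finset.sum_congr rfl fun s _ => by ring

theorem histE_congr {s0 : G.S} {σ : G.Profile} {n : ℕ} {φ ψ : G.Hist → ℝ}
    (h : ∀ x : G.Hist, x.1.length = n → φ x = ψ x) : histE s0 σ n φ = histE s0 σ n ψ :=
  Finset.sum_congr rfl fun x hx => by rw [h x (mem_histN.1 hx)]

theorem histE_mono {s0 : G.S} {σ : G.Profile} {n : ℕ} {φ ψ : G.Hist → ℝ}
    (h : ∀ x : G.Hist, x.1.length = n → φ x ≤ ψ x) : histE s0 σ n φ ≤ histE s0 σ n ψ :=
  Finset.sum_le_sum fun x hx =>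
    mul_le_mul_of_nonneg_left (h x (mem_histN.1 hx)) (probHist_nonneg s0 σ x)

theorem histE_add (s0 : G.S) (σ : G.Profile) (n : ℕ) (φ ψ : G.Hist → ℝ) :
    histE s0 σ n (fun h => φ h + ψ h) = histE s0 σ n φ + histE s0 σ n ψ := by
  simp [histE, mul_add, Finset.sum_add_distrib]

theorem histE_const_mul (s0 : G.S) (σ : G.Profile) (n : ℕ) (c : ℝ) (φ : G.Hist → ℝ) :
    histE s0 σ n (fun h => c * φ h) = c * histE s0 σ n φ := by
  simp only [histE, Finset.mul_sum]
  exact Finset.sum_congr rfl fun x _ => by ring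

theorem histE_sub (s0 : G.S) (σ : G.Profile) (n : ℕ) (φ ψ : G.Hist → ℝ) :
    histE s0 σ n (fun h => φ h - ψ h) = histE s0 σ n φ - histE s0 σ n ψ := by
  simp [histE, mul_sub, Finset.sum_sub_distrib]

theorem nextE_const (σ : G.Profile) (c : ℝ) (h : G.Hist) : nextE σ (fun _ => c) h = c := by
  simp only [nextE, ← Finset.sum_mul, G.q_sum, one_mul, sum_profProb]

theorem histE_const (s0 : G.S) (σ : G.Profile) (n : ℕ) (c : ℝ) :
    histE s0 σ n (fun _ => c) = c := by
  induction n with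
  | zero => rw [histE_zero]
  | succ n ih =>
    rw [histE_succ, histE_congr fun h _ => nextE_const σ c h, ih]

theorem abs_histE_le {s0 : G.S} {σ : G.Profile} {n : ℕ} {φ : G.Hist → ℝ} {C : ℝ}
    (h : ∀ x, |φ x| ≤ C) : |histE s0 σ n φ| ≤ C := by
  rw [abs_le]
  constructor
  · rw [← histE_const s0 σ n (-C)]
    exact histE_mono fun x _ => (abs_le.1 (h x)).1
  · rw [← histE_const s0 σ n C]
    exact histE_mono fun x _ => (abs_le.1 (h x)).2

/-! ### Discounted sums of stage payoffs -/

/-- The stage payoff of the last step of a history. -/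
def lastStep (g : G.Step → ℝ) (h : G.Hist) : ℝ := (h.1.head?.map g).getD 0

theorem nextE_lastStep (σ : G.Profile) (g : G.Step → ℝ) (h : G.Hist) :
    nextE σ (lastStep g) h = stepE σ g h := by
  simp [nextE, stepE, lastStep, snoc, ← Finset.sum_mul, G.q_sum]

theorem abs_stepE_le {σ : G.Profile} {g : G.Step → ℝ} {C : ℝ} (hg : ∀ st, |g st| ≤ C)
    (h : G.Hist) : |stepE σ g h| ≤ C := by
  calc |stepE σ g h| ≤ ∑ a, |profProb σ h a * g ⟨h.2, a⟩| := Finset.abs_sum_le_sum_abs _ _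
    _ ≤ ∑ a, profProb σ h a * C := Finset.sum_le_sum fun a _ => by
        rw [abs_mul, abs_of_nonneg (profProb_nonneg σ h a)]
        exact mul_le_mul_of_nonneg_left (hg _) (profProb_nonneg σ h a)
    _ = C := by rw [← Finset.sum_mul, sum_profProb, one_mul]

theorem exists_step_bound (g : G.Step → ℝ) : ∃ C, 0 ≤ C ∧ ∀ st, |g st| ≤ C := by
  refine ⟨∑ st, |g st|, Finset.sum_nonneg fun _ _ => abs_nonneg _, fun st => ?_⟩
  exact Finset.single_le_sum (f := fun st => |g st|) (fun _ _ => abs_nonneg _)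
    (Finset.mem_univ st)

/-- The `lam`-discounted payoff for a general stage payoff `g`. -/
def disc (lam : ℝ) (s0 : G.S) (σ : G.Profile) (g : G.Step → ℝ) : ℝ :=
  ∑ st, tStep lam s0 σ st * g st

theorem summable_histE {lam : ℝ} (h0 : 0 ≤ lam) (h1 : lam < 1) (s0 : G.S) (σ : G.Profile)
    {φ : G.Hist → ℝ} {C : ℝ} (h : ∀ x, |φ x| ≤ C) :
    Summable fun n : ℕ => lam ^ n * histE s0 σ n φ := by
  refine Summable.of_norm_bounded ((summable_geometric_of_lt_one h0 h1).mul_right C) fun n => ?_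
  rw [norm_mul, Real.norm_eq_abs, Real.norm_eq_abs, abs_of_nonneg (pow_nonneg h0 n)]
  exact mul_le_mul_of_nonneg_left (abs_histE_le h) (pow_nonneg h0 n)

theorem hasSum_hist {f : G.Hist → ℝ} (hf : ∀ h, 0 ≤ f h) {a : ℝ}
    (ha : HasSum (fun n => ∑ h ∈ histN G n, f h) a) : HasSum f a := by
  have key : ∀ n, HasSum (fun h : {h : G.Hist // h.1.length = n} => f h)
      (∑ h ∈ histN G n, f h) := by
    intro n
    have : {h : G.Hist | h.1.length = n} = ↑(histN G n) := by
      ext h; simp [mem_histN]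
    have h2 := (histN G n).hasSum f
    change HasSum (fun h : ({h : G.Hist | h.1.length = n} : Set G.Hist) => f h) _
    rw [this]
    exact h2
  have hs : Summable fun x : (Σ n : ℕ, {h : G.Hist // h.1.length = n}) => f x.2 := by
    rw [summable_sigma_of_nonneg fun x => hf _]
    refine ⟨fun n => (key n).summable, ?_⟩
    refine ha.summable.congr fun n => ?_
    exact (key n).tsum_eq.symm
  have h3 : HasSum (fun x : (Σ n : ℕ, {h : G.Hist // h.1.length = n}) => f x.2) a := by
    have := hs.hasSum.sigma key
    rw [ha.unique this]
    exact hs.hasSum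
  exact (Equiv.sigmaFiberEquiv fun h : G.Hist => h.1.length).hasSum_iff.1 h3

theorem hasSum_tStep {lam : ℝ} (h0 : 0 ≤ lam) (h1 : lam < 1) (s0 : G.S) (σ : G.Profile)
    (st : G.Step) :
    HasSum (fun h : G.Hist =>
      if h.1.head? = some st then lam ^ (h.1.length - 1) * probHist s0 σ h else 0)
      (∑' n : ℕ, lam ^ n * histE s0 σ n (stepE σ (Pi.single st 1))) := by
  refine hasSum_hist (fun h => ?_) ?_
  · split_ifs
    · exact mul_nonneg (pow_nonneg h0 _) (probHist_nonneg s0 σ h)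
    · exact le_rfl
  · obtain ⟨C, -, hC⟩ := exists_step_bound (Pi.single st 1 : G.Step → ℝ)
    have hs := (summable_histE h0 h1 s0 σ (abs_stepE_le (σ := σ) hC)).hasSum
    rw [← hasSum_nat_add_iff' 1]
    simp only [Finset.range_one, Finset.sum_singleton]
    have hz : ∑ h ∈ histN G 0, (if h.1.head? = some st then
        lam ^ (h.1.length - 1) * probHist s0 σ h else 0) = 0 := by
      simp [sum_histN_zero]
    rw [hz, sub_zero]
    refine hs.congr_fun fun n => ?_
    rw [← histE_congr fun h _ => nextE_lastStep σ _ h, ← histE_succ, histE, Finset.mul_sum]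
    refine Finset.sum_congr rfl fun h hh => ?_
    obtain ⟨l, s⟩ := h
    have hl := mem_histN.1 hh
    match l, hl with
    | st' :: rest, hl =>
      have : rest.length = n := by simpa using hl
      by_cases hst : st' = st
      · subst hst
        simp [lastStep, this]
      · simp [lastStep, hst]

theorem hasSum_disc {lam : ℝ} (h0 : 0 ≤ lam) (h1 : lam < 1) (s0 : G.S) (σ : G.Profile)
    (g : G.Step → ℝ) :
    HasSum (fun n : ℕ => (1 - lam) * (lam ^ n * histE s0 σ n (stepE σ g)))
      (disc lam s0 σ g) := by
  have h : ∀ st, HasSum (fun n : ℕ => (1 - lam) *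
      (lam ^ n * histE s0 σ n (stepE σ (Pi.single st 1))) * g st)
      (tStep lam s0 σ st * g st) := by
    intro st
    obtain ⟨C, -, hC⟩ := exists_step_bound (Pi.single st 1 : G.Step → ℝ)
    have hs := (summable_histE h0 h1 s0 σ (abs_stepE_le (σ := σ) hC)).hasSum
    rw [tStep, (hasSum_tStep h0 h1 s0 σ st).tsum_eq]
    exact (hs.mul_left _).mul_right _
  refine (hasSum_sum fun st (_ : st ∈ Finset.univ) => h st).congr_fun fun n => ?_
  have hg : ∀ h : G.Hist, stepE σ g h = ∑ st, stepE σ (Pi.single st 1) h * g st := by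
    intro h
    simp only [stepE, Finset.sum_mul]
    rw [Finset.sum_comm]
    refine Finset.sum_congr rfl fun a _ => ?_
    rw [Finset.sum_eq_single (⟨h.2, a⟩ : G.Step)]
    · simp
    · intro b _ hb
      simp [Ne.symm hb]
    · simp
  have : histE s0 σ n (stepE σ g) = ∑ st, histE s0 σ n (stepE σ (Pi.single st 1)) * g st := by
    simp only [histE, hg, Finset.mul_sum, Finset.sum_mul]
    rw [Finset.sum_comm]
    simp only [mul_assoc]
  rw [this, Finset.mul_sum, Finset.mul_sum]
  exact Finset.sum_congr rfl fun st _ => by ring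

/-! ### Verification of discounted payoffs -/

theorem nextE_const_mul (σ : G.Profile) (c : ℝ) (φ : G.Hist → ℝ) (h : G.Hist) :
    nextE σ (fun x => c * φ x) h = c * nextE σ φ h := by
  simp only [nextE, Finset.mul_sum]
  exact Finset.sum_congr rfl fun a _ => Finset.sum_congr rfl fun s _ => by ring

theorem stepE_const_mul (σ : G.Profile) (c : ℝ) (g : G.Step → ℝ) (h : G.Hist) :
    stepE σ (fun x => c * g x) h = c * stepE σ g h := by
  simp only [stepE, Finset.mul_sum]
  exact Finset.sum_congr rfl fun a _ => by ring

theorem disc_const_mul (lam : ℝ) (s0 : G.S) (σ : G.Profile) (c : ℝ) (g : G.Step → ℝ) :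
    disc lam s0 σ (fun x => c * g x) = c * disc lam s0 σ g := by
  simp only [disc, Finset.mul_sum]
  exact Finset.sum_congr rfl fun a _ => by ring

theorem disc_sub (lam : ℝ) (s0 : G.S) (σ : G.Profile) (g g' : G.Step → ℝ) :
    disc lam s0 σ (fun x => g x - g' x) = disc lam s0 σ g - disc lam s0 σ g' := by
  simp [disc, mul_sub, Finset.sum_sub_distrib]

theorem exists_state_bound (w : G.S → ℝ) : ∃ C, ∀ s, |w s| ≤ C :=
  ⟨∑ s, |w s|, fun s => Finset.single_le_sum (f := fun s => |w s|)
    (fun _ _ => abs_nonneg _) (Finset.mem_univ s)⟩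

theorem le_disc {lam : ℝ} (h0 : 0 ≤ lam) (h1 : lam < 1) {s0 : G.S} {σ : G.Profile}
    {g : G.Step → ℝ} {w : G.S → ℝ}
    (hw : ∀ h : G.Hist, w h.2 ≤ (1 - lam) * stepE σ g h + lam * nextE σ (fun x => w x.2) h) :
    w s0 ≤ disc lam s0 σ g := by
  have key : ∀ N : ℕ, w s0 ≤ ∑ n ∈ Finset.range N,
      (1 - lam) * (lam ^ n * histE s0 σ n (stepE σ g)) +
        lam ^ N * histE s0 σ N (fun x => w x.2) := by
    intro N
    induction N with
    | zero => simp [histE_zero]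
    | succ N ih =>
      rw [Finset.sum_range_succ]
      have h2 : histE s0 σ N (fun x => w x.2) ≤
          (1 - lam) * histE s0 σ N (stepE σ g) + lam * histE s0 σ (N + 1) (fun x => w x.2) := by
        rw [histE_succ, ← histE_const_mul, ← histE_const_mul, ← histE_add]
        exact histE_mono fun x _ => hw x
      have h3 := mul_le_mul_of_nonneg_left h2 (pow_nonneg h0 N)
      rw [pow_succ]
      linarith
  obtain ⟨C, hC⟩ := exists_state_bound w
  have hz : Tendsto (fun N : ℕ => lam ^ N * histE s0 σ N (fun x => w x.2)) atTop (𝓝 0) :=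
    (summable_histE h0 h1 s0 σ fun x => hC x.2).tendsto_atTop_zero
  have := (hasSum_disc h0 h1 s0 σ g).tendsto_sum_nat.add hz
  rw [add_zero] at this
  exact ge_of_tendsto' this key

theorem disc_le {lam : ℝ} (h0 : 0 ≤ lam) (h1 : lam < 1) {s0 : G.S} {σ : G.Profile}
    {g : G.Step → ℝ} {w : G.S → ℝ}
    (hw : ∀ h : G.Hist, (1 - lam) * stepE σ g h + lam * nextE σ (fun x => w x.2) h ≤ w h.2) :
    disc lam s0 σ g ≤ w s0 := by
  have := le_disc (w := fun s => (-1) * w s) (g := fun x => (-1) * g x) (σ := σ) (s0 := s0)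
    h0 h1 (fun h => by
      rw [stepE_const_mul, nextE_const_mul σ (-1) fun x => w x.2]
      linarith [hw h])
  rw [disc_const_mul] at this
  linarith

theorem disc_const {lam : ℝ} (h0 : 0 ≤ lam) (h1 : lam < 1) (s0 : G.S) (σ : G.Profile) (c : ℝ) :
    disc lam s0 σ (fun _ => c) = c := by
  have hw : ∀ h : G.Hist, (1 - lam) * stepE σ (fun _ => c) h +
      lam * nextE σ (fun _ => c) h = c := by
    intro h
    rw [nextE_const, stepE, ← Finset.sum_mul, sum_profProb]
    ring
  exact le_antisymm (disc_le (w := fun _ => c) h0 h1 fun h => (hw h).le)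
    (le_disc (w := fun _ => c) h0 h1 fun h => (hw h).ge)

theorem tStep_nonneg {lam : ℝ} (h0 : 0 ≤ lam) (h1 : lam < 1) (s0 : G.S) (σ : G.Profile)
    (st : G.Step) : 0 ≤ tStep lam s0 σ st := by
  refine mul_nonneg (by linarith) (tsum_nonneg fun h => ?_)
  split_ifs
  · exact mul_nonneg (pow_nonneg h0 _) (probHist_nonneg s0 σ h)
  · exact le_rfl

theorem disc_mono {lam : ℝ} (h0 : 0 ≤ lam) (h1 : lam < 1) {s0 : G.S} {σ : G.Profile}
    {g g' : G.Step → ℝ} (h : ∀ st, g st ≤ g' st) : disc lam s0 σ g ≤ disc lam s0 σ g' :=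
  Finset.sum_le_sum fun st _ => mul_le_mul_of_nonneg_left (h st) (tStep_nonneg h0 h1 s0 σ st)

theorem abs_disc_le {lam : ℝ} (h0 : 0 ≤ lam) (h1 : lam < 1) {s0 : G.S} {σ : G.Profile}
    {g : G.Step → ℝ} {C : ℝ} (h : ∀ st, |g st| ≤ C) : |disc lam s0 σ g| ≤ C := by
  rw [abs_le]
  constructor
  · rw [← disc_const h0 h1 s0 σ (-C)]
    exact disc_mono h0 h1 fun st => (abs_le.1 (h st)).1
  · rw [← disc_const h0 h1 s0 σ C]
    exact disc_mono h0 h1 fun st => (abs_le.1 (h st)).2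

/-! ### The one-shot game and the Shapley operator -/

/-- The expectation of `f` under independent mixed actions. -/
def oneShot {s : G.S} (f : G.Prof s → ℝ) (x : ∀ j, Mixed (G.A j s)) : ℝ :=
  ∑ a, (∏ j, (x j).1 (a j)) * f a

/-- The one-shot payoff with stage payoff `g` and continuation payoff `w`. -/
def bell (lam : ℝ) (g : G.Step → ℝ) (w : G.S → ℝ) (s : G.S) (a : G.Prof s) : ℝ :=
  (1 - lam) * g ⟨s, a⟩ + lam * ∑ s', G.q s a s' * w s'

/-- The mixed action concentrated on `b`. -/
def pureMix {α : Type} [Fintype α] [DecidableEq α] (b : α) : Mixed α :=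
  ⟨Pi.single b 1, fun a => by
    by_cases h : a = b
    · subst h; simp
    · simp [h], by simp⟩

theorem oneShot_bell (σ : G.Profile) (lam : ℝ) (g : G.Step → ℝ) (w : G.S → ℝ) (h : G.Hist) :
    oneShot (bell lam g w h.2) (fun j => σ j h) =
      (1 - lam) * stepE σ g h + lam * nextE σ (fun x => w x.2) h := by
  simp only [oneShot, bell, stepE, nextE, profProb, snoc, mul_add, Finset.sum_add_distrib,
    Finset.mul_sum]
  congr 1
  · exact Finset.sum_congr rfl fun a _ => by ring
  · exact Finset.sum_congr rfl fun a _ => Finset.sum_congr rfl fun s _ => by ring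

theorem oneShot_mono {s : G.S} {f f' : G.Prof s → ℝ} (h : ∀ a, f a ≤ f' a)
    (x : ∀ j, Mixed (G.A j s)) : oneShot f x ≤ oneShot f' x :=
  Finset.sum_le_sum fun a _ => mul_le_mul_of_nonneg_left (h a)
    (Finset.prod_nonneg fun j _ => (x j).2.1 _)

theorem oneShot_add_const {s : G.S} (f : G.Prof s → ℝ) (c : ℝ) (x : ∀ j, Mixed (G.A j s)) :
    oneShot (fun a => f a + c) x = oneShot f x + c := by
  simp only [oneShot, mul_add, Finset.sum_add_distrib, ← Finset.sum_mul, sum_prod_mixed, one_mul]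

theorem prod_update_mixed {s : G.S} (x : ∀ j, Mixed (G.A j s)) (i : G.I) (y : Mixed (G.A i s))
    (a : G.Prof s) : ∏ j, (Function.update x i y j).1 (a j) =
      y.1 (a i) * ∏ j ∈ Finset.univ.erase i, (x j).1 (a j) := by
  rw [← Finset.mul_prod_erase _ _ (Finset.mem_univ i), Function.update_self]
  congr 1
  exact Finset.prod_congr rfl fun j hj => by
    rw [Function.update_of_ne (Finset.ne_of_mem_erase hj)]

theorem oneShot_update {s : G.S} (f : G.Prof s → ℝ) (x : ∀ j, Mixed (G.A j s)) (i : G.I)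
    (y : Mixed (G.A i s)) : oneShot f (Function.update x i y) =
      ∑ b, y.1 b * oneShot f (Function.update x i (pureMix b)) := by
  simp only [oneShot, prod_update_mixed, Finset.mul_sum]
  rw [Finset.sum_comm]
  refine Finset.sum_congr rfl fun a _ => ?_
  rw [Finset.sum_eq_single (a i)]
  · simp [pureMix]
    ring
  · intro b _ hb
    simp [pureMix, Ne.symm hb]
  · simp

instance (α : Type) [Fintype α] : CompactSpace (Mixed α) :=
  isCompact_iff_compactSpace.1 (isCompact_stdSimplex ℝ α)

instance (α : Type) [Fintype α] [DecidableEq α] [Nonempty α] : Nonempty (Mixed α) :=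
  ⟨pureMix (Classical.arbitrary α)⟩

theorem continuous_oneShot {s : G.S} (f : G.Prof s → ℝ) :
    Continuous (oneShot f : (∀ j, Mixed (G.A j s)) → ℝ) := by
  refine continuous_finsetSum _ fun a _ => (continuous_finsetProd _ fun j _ => ?_).mul
    continuous_const
  exact (continuous_apply (a j)).comp (continuous_subtype_val.comp (continuous_apply j))

theorem exists_oneShot_value {s : G.S} (i : G.I) (f : G.Prof s → ℝ) :
    ∃ v : ℝ, (∃ x : ∀ j, Mixed (G.A j s),
      ∀ b, oneShot f (Function.update x i (pureMix b)) ≤ v) ∧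
      ∀ x : ∀ j, Mixed (G.A j s), ∃ b, v ≤ oneShot f (Function.update x i (pureMix b)) := by
  set F : (∀ j, Mixed (G.A j s)) → ℝ := fun x =>
    Finset.univ.sup' Finset.univ_nonempty fun b => oneShot f (Function.update x i (pureMix b))
  have hF : Continuous F := by
    refine Continuous.finset_sup'_apply _ fun b _ => (continuous_oneShot f).comp ?_
    exact continuous_id.update i continuous_const
  obtain ⟨x, -, hx⟩ := isCompact_univ.exists_isMinOn Set.univ_nonempty hF.continuousOn
  refine ⟨F x, ⟨x, fun b => Finset.le_sup' (fun b => oneShot f (Function.update x i (pureMix b)))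
    (Finset.mem_univ b)⟩, fun y => ?_⟩
  obtain ⟨b, -, hb⟩ := Finset.exists_mem_eq_sup' Finset.univ_nonempty
    fun b => oneShot f (Function.update y i (pureMix b))
  exact ⟨b, (hx (Set.mem_univ y)).trans hb.le⟩

theorem exists_bell_fixedPoint {lam : ℝ} (h0 : 0 ≤ lam) (h1 : lam < 1) (g : G.Step → ℝ)
    (V : ∀ s, (G.Prof s → ℝ) → ℝ)
    (hmono : ∀ s (f f' : G.Prof s → ℝ) (e : ℝ), (∀ a, f a ≤ f' a + e) → V s f ≤ V s f' + e) :
    ∃ w : G.S → ℝ, ∀ s, V s (bell lam g w s) = w s := by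
  have hbell : ∀ w w' s (a : G.Prof s), bell lam g w s a ≤ bell lam g w' s a + lam * dist w w' := by
    intro w w' s a
    have : ∑ s', G.q s a s' * w s' ≤ ∑ s', G.q s a s' * (w' s' + dist w w') :=
      Finset.sum_le_sum fun s' _ => mul_le_mul_of_nonneg_left (by
        have := (le_abs_self _).trans ((Real.dist_eq (w s') (w' s')).symm.le.trans
          (dist_le_pi_dist w w' s'))
        linarith) (G.q_nonneg _ _ _)
    simp only [mul_add, Finset.sum_add_distrib, ← Finset.sum_mul, G.q_sum, one_mul] at this
    have := mul_le_mul_of_nonneg_left this h0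
    unfold bell
    linarith
  set T : (G.S → ℝ) → (G.S → ℝ) := fun w s => V s (bell lam g w s)
  have hT : ContractingWith ⟨lam, h0⟩ T := by
    refine ⟨by exact_mod_cast h1, LipschitzWith.of_dist_le_mul fun w w' => ?_⟩
    refine (dist_pi_le_iff (mul_nonneg h0 dist_nonneg)).2 fun s => ?_
    rw [Real.dist_eq, abs_le]
    have e1 := hmono s _ _ _ (hbell w w' s)
    have e2 := hmono s _ _ _ (hbell w' w s)
    rw [dist_comm w' w] at e2
    change -(lam * dist w w') ≤ V s (bell lam g w s) - V s (bell lam g w' s) ∧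
      V s (bell lam g w s) - V s (bell lam g w' s) ≤ lam * dist w w'
    constructor <;> linarith
  have hfix := hT.fixedPoint_isFixedPt
  exact ⟨ContractingWith.fixedPoint T hT, fun s => congrFun hfix s⟩

/-- The value function of the `lam`-discounted game with stage payoff `g`, in which the players
other than `i` minimize player `i`'s payoff and use the stationary strategies `x`. -/
structure IsShapley (i : G.I) (lam : ℝ) (g : G.Step → ℝ) (w : G.S → ℝ) (x : G.StatProf) :
    Prop where
  le_value : ∀ s (y : ∀ j, Mixed (G.A j s)), (∀ j, j ≠ i → y j = x j s) →
    oneShot (bell lam g w s) y ≤ w s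
  value_le : ∀ s (y : ∀ j, Mixed (G.A j s)), ∃ b,
    w s ≤ oneShot (bell lam g w s) (Function.update y i (pureMix b))

theorem exists_shapley (i : G.I) {lam : ℝ} (h0 : 0 ≤ lam) (h1 : lam < 1) (g : G.Step → ℝ) :
    ∃ (w : G.S → ℝ) (x : G.StatProf), IsShapley i lam g w x := by
  choose V hVx hVb using fun (s : G.S) (f : G.Prof s → ℝ) => exists_oneShot_value i f
  have hmono : ∀ s (f f' : G.Prof s → ℝ) (e : ℝ), (∀ a, f a ≤ f' a + e) →
      V s f ≤ V s f' + e := by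
    intro s f f' e hff
    obtain ⟨x, hx⟩ := hVx s f'
    obtain ⟨b, hb⟩ := hVb s f x
    refine hb.trans ((oneShot_mono hff _).trans ?_)
    rw [oneShot_add_const]
    linarith [hx b]
  obtain ⟨w, hw⟩ := exists_bell_fixedPoint h0 h1 g V hmono
  choose x hx using fun s => hVx s (bell lam g w s)
  refine ⟨w, fun j s => x s j, fun s y hy => ?_, fun s y => ?_⟩
  · have : y = Function.update (x s) i (y i) := by
      funext j
      by_cases hj : j = i
      · subst hj; simp
      · simp [hj, hy j hj]
    rw [this, oneShot_update]
    calc _ ≤ ∑ b, (y i).1 b * w s := Finset.sum_le_sum fun b _ =>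
          mul_le_mul_of_nonneg_left ((hx s b).trans (hw s).le) ((y i).2.1 b)
      _ = w s := by rw [← Finset.sum_mul, (y i).2.2, one_mul]
  · rw [← hw s]
    exact hVb s _ y

theorem update_profile_apply (σ : G.Profile) (i : G.I) (σi : G.BStrat i) (h : G.Hist) :
    (fun j => Function.update σ i σi j h) = Function.update (fun j => σ j h) i (σi h) := by
  funext j
  by_cases hj : j = i
  · subst hj; simp
  · simp [hj]

theorem IsShapley.exists_le_disc {i : G.I} {lam : ℝ} (h0 : 0 ≤ lam) (h1 : lam < 1)
    {g : G.Step → ℝ} {w : G.S → ℝ} {x : G.StatProf} (hw : IsShapley i lam g w x)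
    (s0 : G.S) (σ : G.Profile) :
    ∃ σi : G.BStrat i, w s0 ≤ disc lam s0 (Function.update σ i σi) g := by
  choose b hb using fun h : G.Hist => hw.value_le h.2 fun j => σ j h
  refine ⟨fun h => pureMix (b h), le_disc h0 h1 fun h => ?_⟩
  rw [← oneShot_bell, update_profile_apply]
  exact hb h

theorem IsShapley.disc_le {i : G.I} {lam : ℝ} (h0 : 0 ≤ lam) (h1 : lam < 1)
    {g : G.Step → ℝ} {w : G.S → ℝ} {x : G.StatProf} (hw : IsShapley i lam g w x)
    (s0 : G.S) (σi : G.BStrat i) :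
    disc lam s0 (Function.update (toB x) i σi) g ≤ w s0 := by
  refine StocGame.disc_le h0 h1 fun h => ?_
  rw [← oneShot_bell]
  exact hw.le_value _ _ fun j hj => by simp [hj, toB]

theorem IsShapley.abs_le {i : G.I} {lam : ℝ} (h0 : 0 ≤ lam) (h1 : lam < 1)
    {g : G.Step → ℝ} {w : G.S → ℝ} {x : G.StatProf} (hw : IsShapley i lam g w x)
    {C : ℝ} (hg : ∀ st, |g st| ≤ C) (s : G.S) : |w s| ≤ C := by
  obtain ⟨σi, h⟩ := hw.exists_le_disc h0 h1 s (toB x)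
  have h2 := hw.disc_le h0 h1 s σi
  have h3 := le_antisymm h h2
  rw [h3]
  exact abs_disc_le h0 h1 hg

/-! ### Replies to stationary strategies -/

theorem profProb_update (σ : G.Profile) (i : G.I) (σi : G.BStrat i) (h : G.Hist)
    (a : G.Prof h.2) : profProb (Function.update σ i σi) h a =
      (σi h).1 (a i) * ∏ j ∈ Finset.univ.erase i, (σ j h).1 (a j) := by
  rw [← prod_update_mixed (fun j => σ j h), ← update_profile_apply]
  rfl

/-- The payoff `g` averaged over the actions of the players other than `i`. -/
def avgOthers (i : G.I) (x : G.StatProf) (g : G.Step → ℝ) (s : G.S) (b : G.A i s) : ℝ :=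
  oneShot (fun a => g ⟨s, a⟩) (Function.update (fun j => x j s) i (pureMix b))

theorem stepE_eq_oneShot (σ : G.Profile) (g : G.Step → ℝ) (h : G.Hist) :
    stepE σ g h = oneShot (fun a => g ⟨h.2, a⟩) fun j => σ j h := rfl

theorem stepE_update_toB (i : G.I) (x : G.StatProf) (σi : G.BStrat i) (g : G.Step → ℝ)
    (h : G.Hist) : stepE (Function.update (toB x) i σi) g h =
      ∑ b, (σi h).1 b * avgOthers i x g h.2 b := by
  rw [stepE_eq_oneShot, update_profile_apply, oneShot_update]
  rfl

theorem avgOthers_avgOthers (i : G.I) (x : G.StatProf) (g : G.Step → ℝ) (s : G.S) (b : G.A i s) :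
    avgOthers i x (fun st => avgOthers i x g st.1 (st.2 i)) s b = avgOthers i x g s b := by
  conv_lhs => rw [avgOthers, oneShot]
  have : ∀ a : G.Prof s, (∏ j, (Function.update (fun j => x j s) i (pureMix b) j).1 (a j)) *
      avgOthers i x g s (a i) =
      (∏ j, (Function.update (fun j => x j s) i (pureMix b) j).1 (a j)) *
        avgOthers i x g s b := by
    intro a
    rw [prod_update_mixed]
    by_cases hb : a i = b
    · rw [hb]
    · simp [pureMix, hb]
  simp only [this]
  rw [← Finset.sum_mul, sum_prod_mixed, one_mul]

theorem disc_congr {lam : ℝ} (h0 : 0 ≤ lam) (h1 : lam < 1) {s0 : G.S} {σ σ' : G.Profile}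
    {g g' : G.Step → ℝ} (hp : ∀ h, probHist s0 σ h = probHist s0 σ' h)
    (hg : ∀ h, stepE σ g h = stepE σ' g' h) : disc lam s0 σ g = disc lam s0 σ' g' := by
  refine (hasSum_disc h0 h1 s0 σ g).unique ?_
  have : ∀ n, histE s0 σ n (stepE σ g) = histE s0 σ' n (stepE σ' g') := fun n => by
    simp only [histE, hp, hg]
  simp only [this]
  exact hasSum_disc h0 h1 s0 σ' g'

theorem disc_avgOthers {lam : ℝ} (h0 : 0 ≤ lam) (h1 : lam < 1) (s0 : G.S) (i : G.I)
    (x : G.StatProf) (σi : G.BStrat i) (g : G.Step → ℝ) :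
    disc lam s0 (Function.update (toB x) i σi) g =
      disc lam s0 (Function.update (toB x) i σi) fun st => avgOthers i x g st.1 (st.2 i) := by
  refine disc_congr h0 h1 (fun _ => rfl) fun h => ?_
  rw [stepE_update_toB, stepE_update_toB]
  exact Finset.sum_congr rfl fun b _ => by rw [avgOthers_avgOthers]

theorem exists_stat_conditional {lam : ℝ} (h0 : 0 ≤ lam) (h1 : lam < 1) (s0 : G.S) (i : G.I)
    (σ : G.Profile) : ∃ (xi : G.Stat i) (m : G.S → ℝ), ∀ s b,
      (∑ a : G.Prof s, if a i = b then tStep lam s0 σ ⟨s, a⟩ else 0) = m s * (xi s).1 b := by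
  have : ∀ s, ∃ (y : Mixed (G.A i s)) (m : ℝ), ∀ b,
      (∑ a : G.Prof s, if a i = b then tStep lam s0 σ ⟨s, a⟩ else 0) = m * y.1 b := by
    intro s
    set M : G.A i s → ℝ := fun b => ∑ a : G.Prof s, if a i = b then tStep lam s0 σ ⟨s, a⟩ else 0
    have hM : ∀ b, 0 ≤ M b := fun b => Finset.sum_nonneg fun a _ => by
      split_ifs
      · exact tStep_nonneg h0 h1 _ _ _
      · exact le_rfl
    by_cases hm : ∑ b, M b = 0
    · refine ⟨pureMix (Classical.arbitrary _), 0, fun b => ?_⟩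
      rw [zero_mul]
      exact (Finset.sum_eq_zero_iff_of_nonneg fun b _ => hM b).1 hm b (Finset.mem_univ b)
    · refine ⟨⟨fun b => M b / ∑ b, M b, fun b => div_nonneg (hM b)
        (Finset.sum_nonneg fun b _ => hM b), ?_⟩, ∑ b, M b, fun b => ?_⟩
      · rw [← Finset.sum_div, div_self hm]
      · rw [mul_div_cancel₀ _ hm]
  choose y m h using this
  exact ⟨y, m, h⟩

theorem disc_own_action (lam : ℝ) (s0 : G.S) (i : G.I) (σ : G.Profile)
    {xi : G.Stat i} {m : G.S → ℝ}
    (hm : ∀ s b, (∑ a : G.Prof s, if a i = b then tStep lam s0 σ ⟨s, a⟩ else 0) =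
      m s * (xi s).1 b) (k : ∀ s, G.A i s → ℝ) :
    disc lam s0 σ (fun st => k st.1 (st.2 i)) = ∑ s, m s * ∑ b, (xi s).1 b * k s b := by
  rw [disc, Fintype.sum_sigma]
  refine Finset.sum_congr rfl fun s _ => ?_
  rw [Finset.mul_sum]
  simp only [← mul_assoc, ← hm, Finset.sum_mul]
  rw [Finset.sum_comm]
  refine Finset.sum_congr rfl fun a _ => ?_
  rw [Finset.sum_eq_single (a i)]
  · simp
  · intro b _ hb
    simp [Ne.symm hb]
  · simp

/-- Against stationary strategies, player `i` has for each strategy a stationary strategy that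
induces the same discounted occupation measure. -/
theorem exists_stat_disc_eq {lam : ℝ} (h0 : 0 ≤ lam) (h1 : lam < 1) (s0 : G.S) (i : G.I)
    (x : G.StatProf) (σi : G.BStrat i) : ∃ xi : G.Stat i, ∀ g : G.Step → ℝ,
      disc lam s0 (Function.update (toB x) i (toB1 xi)) g =
        disc lam s0 (Function.update (toB x) i σi) g := by
  obtain ⟨xi, m, hm⟩ := exists_stat_conditional h0 h1 s0 i (Function.update (toB x) i σi)
  refine ⟨xi, fun g => ?_⟩
  obtain ⟨w, hw⟩ := exists_bell_fixedPoint h0 h1 g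
    (fun s f => oneShot f (Function.update (fun j => x j s) i (xi s)))
    (fun s f f' e h => (oneShot_mono h _).trans (oneShot_add_const _ _ _).le)
  have h1' : (1 - lam) ≠ 0 := by linarith
  set g' : G.Step → ℝ := fun st =>
    (1 - lam)⁻¹ * (w st.1 - lam * ∑ s', G.q st.1 st.2 s' * w s')
  have hg' : ∀ s a, bell lam g' w s a = w s := by
    intro s a
    simp only [bell, g']
    rw [mul_inv_cancel_left₀ h1']
    ring
  have hstat : disc lam s0 (Function.update (toB x) i (toB1 xi)) g = w s0 := by
    have key : ∀ h : G.Hist, (1 - lam) * stepE (Function.update (toB x) i (toB1 xi)) g h +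
        lam * nextE (Function.update (toB x) i (toB1 xi)) (fun x => w x.2) h = w h.2 := by
      intro h
      rw [← oneShot_bell, update_profile_apply]
      exact hw h.2
    exact le_antisymm (disc_le h0 h1 fun h => (key h).le) (le_disc h0 h1 fun h => (key h).ge)
  have hbeh : ∀ σ : G.Profile, disc lam s0 σ g' = w s0 := by
    intro σ
    have key : ∀ h : G.Hist, (1 - lam) * stepE σ g' h +
        lam * nextE σ (fun x => w x.2) h = w h.2 := by
      intro h
      rw [← oneShot_bell, oneShot]
      simp only [hg']
      rw [← Finset.sum_mul, sum_prod_mixed, one_mul]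
    exact le_antisymm (disc_le h0 h1 fun h => (key h).le) (le_disc h0 h1 fun h => (key h).ge)
  have hzero : disc lam s0 (Function.update (toB x) i σi) (fun st => g st - g' st) = 0 := by
    rw [disc_avgOthers h0 h1, disc_own_action lam s0 i _ hm]
    refine Finset.sum_eq_zero fun s _ => ?_
    simp only [avgOthers]
    rw [← oneShot_update]
    have e1 : (1 - lam) * oneShot (fun a => g ⟨s, a⟩ - g' ⟨s, a⟩)
        (Function.update (fun j => x j s) i (xi s)) =
        oneShot (bell lam g w s) (Function.update (fun j => x j s) i (xi s)) -
        oneShot (bell lam g' w s) (Function.update (fun j => x j s) i (xi s)) := by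
      simp only [oneShot, Finset.mul_sum, ← Finset.sum_sub_distrib, bell]
      exact Finset.sum_congr rfl fun a _ => by ring
    have e2 : oneShot (bell lam g' w s) (Function.update (fun j => x j s) i (xi s)) = w s := by
      simp only [oneShot, hg']
      rw [← Finset.sum_mul, sum_prod_mixed, one_mul]
    rw [hw s, e2, sub_self] at e1
    rw [(mul_eq_zero.1 e1).resolve_left h1', mul_zero]
  rw [disc_sub, hbeh] at hzero
  rw [hstat]
  linarith

/-! ### Mixtures of strategies of one player -/

/-- The contribution of player `i`'s strategy to the probability of a history. -/
def ownProb {i : G.I} (τ : G.BStrat i) : List G.Step → ℝ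
  | [] => 1
  | ⟨s', a⟩ :: rest => ownProb τ rest * (τ (rest, s')).1 (a i)

theorem ownProb_nonneg {i : G.I} (τ : G.BStrat i) (l : List G.Step) : 0 ≤ ownProb τ l := by
  induction l with
  | nil => simp [ownProb]
  | cons st rest ih => exact mul_nonneg ih ((τ _).2.1 _)

theorem exists_probHist_update_eq (s0 : G.S) (σ : G.Profile) (i : G.I) (h : G.Hist) :
    ∃ r : ℝ, ∀ τ : G.BStrat i, probHist s0 (Function.update σ i τ) h = ownProb τ h.1 * r := by
  obtain ⟨l, s⟩ := h
  induction l generalizing s with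
  | nil => exact ⟨if s = s0 then 1 else 0, fun τ => by simp [probHist, probHistAux, ownProb]⟩
  | cons st rest ih =>
    obtain ⟨r, hr⟩ := ih st.1
    refine ⟨r * (∏ j ∈ Finset.univ.erase i, (σ j (rest, st.1)).1 (st.2 j)) *
      G.q st.1 st.2 s, fun τ => ?_⟩
    have := probHist_snoc s0 (Function.update σ i τ) (rest, st.1) st.2 s
    rw [profProb_update, hr] at this
    change probHist s0 (Function.update σ i τ) (st :: rest, s) = _ at this
    rw [this]
    simp only [ownProb]
    ring

theorem exists_mixture {i : G.I} (τ₁ τ₂ : G.BStrat i) {μ ν : ℝ} (hμ : 0 ≤ μ) (hν : 0 ≤ ν)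
    (hs : μ + ν = 1) :
    ∃ τ : G.BStrat i, ∀ l, ownProb τ l = μ * ownProb τ₁ l + ν * ownProb τ₂ l := by
  set W : List G.Step → ℝ := fun l => μ * ownProb τ₁ l + ν * ownProb τ₂ l
  have e : ∀ h : G.Hist, ∃ y : Mixed (G.A i h.2), ∀ b, W h.1 * y.1 b =
      μ * (ownProb τ₁ h.1 * (τ₁ h).1 b) + ν * (ownProb τ₂ h.1 * (τ₂ h).1 b) := by
    intro h
    have a1 := mul_nonneg hμ (ownProb_nonneg τ₁ h.1)
    have a2 := mul_nonneg hν (ownProb_nonneg τ₂ h.1)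
    by_cases hW : W h.1 = 0
    · refine ⟨τ₁ h, fun b => ?_⟩
      have b1 : μ * ownProb τ₁ h.1 = 0 := by simp only [W] at hW; linarith
      have b2 : ν * ownProb τ₂ h.1 = 0 := by simp only [W] at hW; linarith
      rw [hW, ← mul_assoc, ← mul_assoc, b1, b2]
      ring
    · refine ⟨⟨fun b => (μ * (ownProb τ₁ h.1 * (τ₁ h).1 b) +
        ν * (ownProb τ₂ h.1 * (τ₂ h).1 b)) / W h.1, fun b => ?_, ?_⟩, fun b => ?_⟩
      · refine div_nonneg (add_nonneg ?_ ?_) (add_nonneg a1 a2)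
        · exact mul_nonneg hμ (mul_nonneg (ownProb_nonneg _ _) ((τ₁ h).2.1 b))
        · exact mul_nonneg hν (mul_nonneg (ownProb_nonneg _ _) ((τ₂ h).2.1 b))
      · rw [← Finset.sum_div, Finset.sum_add_distrib, ← Finset.mul_sum, ← Finset.mul_sum,
          ← Finset.mul_sum, ← Finset.mul_sum, (τ₁ h).2.2, (τ₂ h).2.2, mul_one, mul_one]
        exact div_self hW
      · exact mul_div_cancel₀ _ hW
  choose τ hτ using e
  refine ⟨τ, fun l => ?_⟩
  induction l with
  | nil => simp [ownProb, hs]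
  | cons st rest ih =>
    simp only [ownProb]
    rw [ih]
    exact hτ (rest, st.1) (st.2 i)

/-- Discounted occupation measures are affine under Kuhn mixtures of strategies of player `i`. -/
theorem exists_tStep_mixture {lam : ℝ} (h0 : 0 ≤ lam) (h1 : lam < 1) (s0 : G.S) (σ : G.Profile)
    {i : G.I} (τ₁ τ₂ : G.BStrat i) {μ ν : ℝ} (hμ : 0 ≤ μ) (hν : 0 ≤ ν) (hs : μ + ν = 1) :
    ∃ τ : G.BStrat i, ∀ st, tStep lam s0 (Function.update σ i τ) st =
      μ * tStep lam s0 (Function.update σ i τ₁) st +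
        ν * tStep lam s0 (Function.update σ i τ₂) st := by
  obtain ⟨τ, hτ⟩ := exists_mixture τ₁ τ₂ hμ hν hs
  have hp : ∀ h, probHist s0 (Function.update σ i τ) h =
      μ * probHist s0 (Function.update σ i τ₁) h +
        ν * probHist s0 (Function.update σ i τ₂) h := by
    intro h
    obtain ⟨r, hr⟩ := exists_probHist_update_eq s0 σ i h
    rw [hr, hr, hr, hτ]
    ring
  refine ⟨τ, fun st => ?_⟩
  have s1 := (hasSum_tStep h0 h1 s0 (Function.update σ i τ₁) st).summable.hasSum.mul_left μ
  have s2 := (hasSum_tStep h0 h1 s0 (Function.update σ i τ₂) st).summable.hasSum.mul_left ν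
  rw [tStep, ((s1.add s2).congr_fun fun h => ?_).tsum_eq, tStep, tStep]
  · ring
  · rw [hp]
    split_ifs <;> ring

/-! ### The modified game as a minimum of ordinary discounted games -/

/-- The stage payoff that, in the element `D` of the partition, mixes the stage payoff of
player `i` and the cutoff `c D` with weights `α D` and `1 - α D`. -/
def cutPay (i : G.I) (Di : Finset (Finset G.S)) (c α : Finset G.S → ℝ) (st : G.Step) : ℝ :=
  ∑ D ∈ Di, if st.1 ∈ D then α D * G.u i st.1 st.2 + (1 - α D) * c D else 0

theorem disc_cutPay (lam : ℝ) (s0 : G.S) (σ : G.Profile) (i : G.I) (Di : Finset (Finset G.S))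
    (c α : Finset G.S → ℝ) : disc lam s0 σ (cutPay i Di c α) =
      ∑ D ∈ Di, (α D * UD lam s0 σ i D + (1 - α D) * (tSet lam s0 σ D * c D)) := by
  simp only [disc, cutPay, Finset.mul_sum]
  rw [Finset.sum_comm]
  refine Finset.sum_congr rfl fun D _ => ?_
  rw [UD, tSet, Finset.sum_mul, Finset.mul_sum, Finset.mul_sum, ← Finset.sum_add_distrib]
  refine Finset.sum_congr rfl fun st _ => ?_
  split_ifs <;> ring

theorem exists_modPayoff_eq (lam : ℝ) (s0 : G.S) (σ : G.Profile) (i : G.I)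
    (Di : Finset (Finset G.S)) (c : Finset G.S → ℝ) :
    ∃ α ∈ Set.Icc (0 : Finset G.S → ℝ) 1,
      modPayoff lam s0 σ i Di c = disc lam s0 σ (cutPay i Di c α) := by
  refine ⟨fun D => if UD lam s0 σ i D ≤ tSet lam s0 σ D * c D then 1 else 0,
    ⟨fun D => ?_, fun D => ?_⟩, ?_⟩
  · change (0 : ℝ) ≤ ite _ _ _
    split_ifs <;> norm_num
  · change ite _ _ _ ≤ (1 : ℝ)
    split_ifs <;> norm_num
  · rw [disc_cutPay, modPayoff]
    refine Finset.sum_congr rfl fun D _ => ?_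
    split_ifs with h
    · rw [min_eq_left h]; ring
    · rw [min_eq_right (not_le.1 h).le]; ring

theorem modPayoff_le_disc (lam : ℝ) (s0 : G.S) (σ : G.Profile) (i : G.I)
    (Di : Finset (Finset G.S)) (c : Finset G.S → ℝ) {α : Finset G.S → ℝ}
    (hα : α ∈ Set.Icc (0 : Finset G.S → ℝ) 1) :
    modPayoff lam s0 σ i Di c ≤ disc lam s0 σ (cutPay i Di c α) := by
  rw [disc_cutPay, modPayoff]
  refine Finset.sum_le_sum fun D _ => ?_
  have h0 : 0 ≤ α D := hα.1 D
  have h1 : α D ≤ 1 := hα.2 D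
  have e1 := mul_le_mul_of_nonneg_left
    (min_le_left (UD lam s0 σ i D) (tSet lam s0 σ D * c D)) h0
  have e2 := mul_le_mul_of_nonneg_left
    (min_le_right (UD lam s0 σ i D) (tSet lam s0 σ D * c D)) (sub_nonneg.2 h1)
  linarith

/-- The stage payoff of player `i` as a function of the step. -/
def stagePay (i : G.I) (st : G.Step) : ℝ := G.u i st.1 st.2

theorem abs_stagePay_le (i : G.I) (st : G.Step) : |stagePay i st| ≤ 1 := G.u_bdd i st.1 st.2

theorem payoffD_eq_disc (lam : ℝ) (s0 : G.S) (σ : G.Profile) (i : G.I) :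
    payoffD lam s0 σ i = disc lam s0 σ (stagePay i) := rfl

theorem IsPartitionF.exists_sum_eq {Di : Finset (Finset G.S)} (hDi : IsPartitionF Di) (s : G.S) :
    ∃ D ∈ Di, s ∈ D ∧ ∀ f : Finset G.S → ℝ, (∑ D ∈ Di, if s ∈ D then f D else 0) = f D := by
  obtain ⟨D, ⟨hD, hs⟩, hu⟩ := hDi s
  refine ⟨D, hD, hs, fun f => ?_⟩
  rw [Finset.sum_eq_single_of_mem D hD fun D' hD' hne =>
    if_neg fun h => hne (hu D' ⟨hD', h⟩), if_pos hs]

theorem cutPay_one {Di : Finset (Finset G.S)} (hDi : IsPartitionF Di) (i : G.I)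
    (c : Finset G.S → ℝ) : cutPay i Di c 1 = stagePay i := by
  funext st
  obtain ⟨D, -, -, h⟩ := hDi.exists_sum_eq st.1
  rw [cutPay, h fun D => (1 : Finset G.S → ℝ) D * G.u i st.1 st.2 +
    (1 - (1 : Finset G.S → ℝ) D) * c D]
  simp [stagePay]

theorem modPayoff_le_payoffD {Di : Finset (Finset G.S)} (hDi : IsPartitionF Di) (lam : ℝ)
    (s0 : G.S) (σ : G.Profile) (i : G.I) (c : Finset G.S → ℝ) :
    modPayoff lam s0 σ i Di c ≤ payoffD lam s0 σ i := by
  rw [payoffD_eq_disc, ← cutPay_one hDi i c]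
  exact modPayoff_le_disc _ _ _ _ _ _ ⟨fun _ => zero_le_one, le_rfl⟩

/-- A bound on the stage payoffs `cutPay`. -/
def cutBound (Di : Finset (Finset G.S)) (c : Finset G.S → ℝ) : ℝ := 1 + ∑ D ∈ Di, |c D|

theorem one_le_cutBound (Di : Finset (Finset G.S)) (c : Finset G.S → ℝ) : 1 ≤ cutBound Di c :=
  le_add_of_nonneg_right (Finset.sum_nonneg fun _ _ => abs_nonneg _)

theorem abs_cutPay_le {Di : Finset (Finset G.S)} (hDi : IsPartitionF Di) (i : G.I)
    (c : Finset G.S → ℝ) {α : Finset G.S → ℝ} (hα : α ∈ Set.Icc (0 : Finset G.S → ℝ) 1)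
    (st : G.Step) : |cutPay i Di c α st| ≤ cutBound Di c := by
  obtain ⟨D, hD, -, h⟩ := hDi.exists_sum_eq st.1
  rw [cutPay, h fun D => α D * G.u i st.1 st.2 + (1 - α D) * c D]
  have h0 : 0 ≤ α D := hα.1 D
  have h1 : α D ≤ 1 := hα.2 D
  have hc : |c D| ≤ ∑ D ∈ Di, |c D| :=
    Finset.single_le_sum (f := fun D => |c D|) (fun _ _ => abs_nonneg _) hD
  have hu := G.u_bdd i st.1 st.2
  have := abs_nonneg (c D)
  calc _ ≤ |α D * G.u i st.1 st.2| + |(1 - α D) * c D| := abs_add_le _ _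
    _ = α D * |G.u i st.1 st.2| + (1 - α D) * |c D| := by
      rw [abs_mul, abs_mul, abs_of_nonneg h0, abs_of_nonneg (sub_nonneg.2 h1)]
    _ ≤ cutBound Di c := by
      rw [cutBound]
      nlinarith

theorem abs_modPayoff_le {Di : Finset (Finset G.S)} (hDi : IsPartitionF Di) {lam : ℝ}
    (h0 : 0 ≤ lam) (h1 : lam < 1) (s0 : G.S) (σ : G.Profile) (i : G.I) (c : Finset G.S → ℝ) :
    |modPayoff lam s0 σ i Di c| ≤ cutBound Di c := by
  obtain ⟨α, hα, h⟩ := exists_modPayoff_eq lam s0 σ i Di c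
  rw [h]
  exact abs_disc_le h0 h1 fun st => abs_cutPay_le hDi i c hα st

theorem cutPay_affine (i : G.I) (Di : Finset (Finset G.S)) (c α β : Finset G.S → ℝ) {a b : ℝ}
    (hab : a + b = 1) (st : G.Step) : cutPay i Di c (a • α + b • β) st =
      a * cutPay i Di c α st + b * cutPay i Di c β st := by
  simp only [cutPay, Finset.mul_sum, ← Finset.sum_add_distrib]
  refine Finset.sum_congr rfl fun D _ => ?_
  obtain rfl : b = 1 - a := by linarith
  split_ifs
  · simp only [Pi.add_apply, Pi.smul_apply, smul_eq_mul]
    ring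
  · ring

theorem exists_modPayoff_gt {lam : ℝ} (h0 : 0 ≤ lam) (h1 : lam < 1) (s0 : G.S) (σ : G.Profile)
    (i : G.I) (Di : Finset (Finset G.S)) (c : Finset G.S → ℝ) {t : ℝ}
    (ht : ∀ α ∈ Set.Icc (0 : Finset G.S → ℝ) 1, ∃ σi : G.BStrat i,
      t < disc lam s0 (Function.update σ i σi) (cutPay i Di c α)) :
    ∃ σi : G.BStrat i, t < modPayoff lam s0 (Function.update σ i σi) i Di c := by
  set f : (Finset G.S → ℝ) → (G.Step → ℝ) → ℝ := fun α y => ∑ st, y st * cutPay i Di c α st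
  set Y : Set (G.Step → ℝ) := Set.range fun σi : G.BStrat i =>
    tStep lam s0 (Function.update σ i σi)
  have hcont : ∀ y, Continuous fun α => f α y := by
    intro y
    refine continuous_finsetSum _ fun st _ => continuous_const.mul ?_
    refine continuous_finsetSum _ fun D _ => ?_
    split_ifs
    · fun_prop
    · exact continuous_const
  have hX : IsCompact (Set.Icc (0 : Finset G.S → ℝ) 1) := isCompact_Icc
  choose! σc hσc using ht
  obtain ⟨T, hTX, hT⟩ := hX.elim_nhds_subcover
    (fun α => {β | t < f β (tStep lam s0 (Function.update σ i (σc α)))}) fun α hα =>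
      (isOpen_lt continuous_const (hcont _)).mem_nhds (hσc α hα)
  have hY : Convex ℝ Y := by
    rintro _ ⟨τ₁, rfl⟩ _ ⟨τ₂, rfl⟩ a b ha hb hab
    obtain ⟨τ, hτ⟩ := exists_tStep_mixture h0 h1 s0 σ τ₁ τ₂ ha hb hab
    exact ⟨τ, funext fun st => by simp [hτ]⟩
  obtain ⟨_, ⟨σi, rfl⟩, h⟩ := Sion.exists_lt_iInf_of_lt_iInf_of_finite (f := f) (Y := Y) (t := t)
    (Set.nonempty_Icc.2 (zero_le_one (α := Finset G.S → ℝ))) hX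
    (fun y _ => (hcont y).lowerSemicontinuous.lowerSemicontinuousOn _)
    (fun y _ => ConvexOn.quasiconvexOn ⟨convex_Icc _ _, fun α _ β _ a b _ _ hab => by
      refine le_of_eq ?_
      simp only [f, cutPay_affine i Di c α β hab, smul_eq_mul, Finset.mul_sum,
        ← Finset.sum_add_distrib]
      exact Finset.sum_congr rfl fun st _ => by ring⟩)
    hY
    (fun α _ => (Continuous.upperSemicontinuous (by fun_prop)).upperSemicontinuousOn _)
    (fun α _ => ConcaveOn.quasiconcaveOn ⟨hY, fun y _ z _ a b _ _ hab => by
      refine le_of_eq ?_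
      simp only [f, smul_eq_mul, Finset.mul_sum, ← Finset.sum_add_distrib]
      exact Finset.sum_congr rfl fun st _ => by
        simp only [Pi.add_apply, Pi.smul_apply, smul_eq_mul]
        ring⟩)
    (convex_Icc _ _)
    (T.finite_toSet.image fun α => tStep lam s0 (Function.update σ i (σc α)))
    (by rintro _ ⟨α, -, rfl⟩; exact ⟨_, rfl⟩)
    (fun α hα => by
      obtain ⟨β, hβ, hαβ⟩ := Set.mem_iUnion₂.1 (hT hα)
      exact ⟨_, ⟨β, hβ, rfl⟩, hαβ⟩)
  refine ⟨σi, ?_⟩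
  obtain ⟨α, hα, he⟩ := exists_modPayoff_eq lam s0 (Function.update σ i σi) i Di c
  rw [he]
  exact h α hα

/-! ### Bounds on the min-max values -/

theorem bddAbove_of_abs {ι : Type*} {f : ι → ℝ} {C : ℝ} (h : ∀ x, |f x| ≤ C) :
    BddAbove (Set.range f) :=
  ⟨C, by rintro _ ⟨x, rfl⟩; exact (abs_le.1 (h x)).2⟩

theorem iInf_iSup_le {ι κ : Type*} [Nonempty κ] {f : ι → κ → ℝ} {C t : ℝ}
    (hC : ∀ x y, |f x y| ≤ C) (x : ι) (ht : ∀ y, f x y ≤ t) : ⨅ x, ⨆ y, f x y ≤ t := by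
  refine (ciInf_le ⟨-C, ?_⟩ x).trans (ciSup_le ht)
  rintro _ ⟨x, rfl⟩
  exact (abs_le.1 (hC x (Classical.arbitrary κ))).1.trans
    (le_ciSup (bddAbove_of_abs (hC x)) _)

theorem le_iInf_iSup {ι κ : Type*} [Nonempty ι] {f : ι → κ → ℝ} {C t : ℝ}
    (hC : ∀ x y, |f x y| ≤ C) (ht : ∀ x, ∃ y, t ≤ f x y) : t ≤ ⨅ x, ⨆ y, f x y := by
  refine le_ciInf fun x => ?_
  obtain ⟨y, hy⟩ := ht x
  exact hy.trans (le_ciSup (bddAbove_of_abs (hC x)) y)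

theorem IsShapley.minmaxOrig_eq {i : G.I} {lam : ℝ} (h0 : 0 ≤ lam) (h1 : lam < 1)
    {w : G.S → ℝ} {x : G.StatProf} (hw : IsShapley i lam (stagePay i) w x) (s0 : G.S) :
    minmaxOrig G lam s0 i = w s0 := by
  have hC : ∀ (σ : G.Profile) (σi : G.BStrat i),
      |payoffD lam s0 (Function.update σ i σi) i| ≤ 1 := fun σ σi =>
    abs_disc_le h0 h1 (abs_stagePay_le i)
  have : Nonempty G.Profile := ⟨toB x⟩
  have : Nonempty (G.BStrat i) := ⟨toB x i⟩
  exact le_antisymm (iInf_iSup_le hC (toB x) fun σi => hw.disc_le h0 h1 s0 σi)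
    (le_iInf_iSup hC fun σ => hw.exists_le_disc h0 h1 s0 σ)

theorem IsShapley.minmaxMod_le {i : G.I} {lam : ℝ} (h0 : 0 ≤ lam) (h1 : lam < 1)
    {w : G.S → ℝ} {x : G.StatProf} (hw : IsShapley i lam (stagePay i) w x)
    {Di : Finset (Finset G.S)} (hDi : IsPartitionF Di) (c : Finset G.S → ℝ) (s0 : G.S) :
    minmaxMod G lam s0 i Di c ≤ w s0 := by
  have : Nonempty (G.BStrat i) := ⟨toB x i⟩
  exact iInf_iSup_le (fun σ σi => abs_modPayoff_le hDi h0 h1 s0 _ i c) (toB x) fun σi =>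
    (modPayoff_le_payoffD hDi lam s0 _ i c).trans (hw.disc_le h0 h1 s0 σi)

theorem IsShapley.minmaxModStat_le {i : G.I} {lam : ℝ} (h0 : 0 ≤ lam) (h1 : lam < 1)
    {w : G.S → ℝ} {x : G.StatProf} (hw : IsShapley i lam (stagePay i) w x)
    {Di : Finset (Finset G.S)} (hDi : IsPartitionF Di) (c : Finset G.S → ℝ) (s0 : G.S) :
    minmaxModStat G lam s0 i Di c ≤ w s0 := by
  have : Nonempty (G.Stat i) := ⟨x i⟩
  exact iInf_iSup_le (fun x xi => abs_modPayoff_le hDi h0 h1 s0 _ i c) x fun xi =>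
    (modPayoff_le_payoffD hDi lam s0 _ i c).trans (hw.disc_le h0 h1 s0 _)

theorem exists_lt_modPayoff_of_shapley {i : G.I} {lam : ℝ} (h0 : 0 ≤ lam) (h1 : lam < 1)
    {Di : Finset (Finset G.S)} {c : Finset G.S → ℝ} {s0 : G.S} {t : ℝ}
    (ht : ∀ α ∈ Set.Icc (0 : Finset G.S → ℝ) 1, ∀ w x,
      IsShapley i lam (cutPay i Di c α) w x → t < w s0) (σ : G.Profile) :
    ∃ σi : G.BStrat i, t < modPayoff lam s0 (Function.update σ i σi) i Di c := by
  refine exists_modPayoff_gt h0 h1 s0 σ i Di c fun α hα => ?_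
  obtain ⟨w, x, hw⟩ := exists_shapley i h0 h1 (cutPay i Di c α)
  obtain ⟨σi, h⟩ := hw.exists_le_disc h0 h1 s0 σ
  exact ⟨σi, (ht α hα w x hw).trans_le h⟩

theorem le_minmaxMod_of_shapley {i : G.I} {lam : ℝ} (h0 : 0 ≤ lam) (h1 : lam < 1)
    {Di : Finset (Finset G.S)} (hDi : IsPartitionF Di) {c : Finset G.S → ℝ} {s0 : G.S} {t : ℝ}
    (ht : ∀ α ∈ Set.Icc (0 : Finset G.S → ℝ) 1, ∀ w x,
      IsShapley i lam (cutPay i Di c α) w x → t < w s0) :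
    t ≤ minmaxMod G lam s0 i Di c := by
  have : Nonempty G.Profile := ⟨fun j h => pureMix (Classical.arbitrary _)⟩
  refine le_iInf_iSup (fun σ σi => abs_modPayoff_le hDi h0 h1 s0 _ i c) fun σ => ?_
  obtain ⟨σi, h⟩ := exists_lt_modPayoff_of_shapley h0 h1 ht σ
  exact ⟨σi, h.le⟩

theorem le_minmaxModStat_of_shapley {i : G.I} {lam : ℝ} (h0 : 0 ≤ lam) (h1 : lam < 1)
    {Di : Finset (Finset G.S)} (hDi : IsPartitionF Di) {c : Finset G.S → ℝ} {s0 : G.S} {t : ℝ}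
    (ht : ∀ α ∈ Set.Icc (0 : Finset G.S → ℝ) 1, ∀ w x,
      IsShapley i lam (cutPay i Di c α) w x → t < w s0) :
    t ≤ minmaxModStat G lam s0 i Di c := by
  have : Nonempty G.StatProf := ⟨fun j s => pureMix (Classical.arbitrary _)⟩
  refine le_iInf_iSup (fun x xi => abs_modPayoff_le hDi h0 h1 s0 _ i c) fun x => ?_
  obtain ⟨σi, h⟩ := exists_lt_modPayoff_of_shapley h0 h1 ht (toB x)
  obtain ⟨xi, hxi⟩ := exists_stat_disc_eq h0 h1 s0 i x σi
  refine ⟨xi, h.le.trans ?_⟩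
  obtain ⟨α, hα, he⟩ := exists_modPayoff_eq lam s0 (Function.update (toB x) i (toB1 xi)) i Di c
  rw [he, hxi]
  exact modPayoff_le_disc _ _ _ _ _ _ hα

/-! ### Functions of finitely many stages of a play -/

/-- The state at stage `T` of a history with reversed list of steps `l` and current state `s`
(and the current state, if the stage `T` has not been reached). -/
def sAtAux (T : ℕ) : List G.Step → G.S → G.S
  | [], s => s
  | st :: rest, s => if rest.length + 1 ≤ T then s else sAtAux T rest st.1

/-- The state at stage `T` of the history `h`. -/
def sAt (T : ℕ) (h : G.Hist) : G.S := sAtAux T h.1 h.2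

theorem sAt_of_length_le {T : ℕ} {h : G.Hist} (hT : h.1.length ≤ T) : sAt T h = h.2 := by
  obtain ⟨l, s⟩ := h
  cases l with
  | nil => rfl
  | cons st rest => exact if_pos hT

theorem sAt_snoc {T : ℕ} {h : G.Hist} (hT : T ≤ h.1.length) (a : G.Prof h.2) (s : G.S) :
    sAt T (snoc h a s) = sAt T h :=
  if_neg (by omega)

theorem length_histOf (p : G.Play) (n : ℕ) : (histOf p n).1.length = n := by
  induction n with
  | zero => rfl
  | succ n ih => simp [histOf, ih]

theorem histOf_snd (p : G.Play) (n : ℕ) : (histOf p n).2 = (p n).1 := by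
  cases n <;> rfl

theorem sAt_histOf (p : G.Play) {T n : ℕ} (h : T ≤ n) : sAt T (histOf p n) = (p T).1 := by
  induction n with
  | zero =>
    obtain rfl : T = 0 := by omega
    rfl
  | succ n ih =>
    rcases h.eq_or_lt with rfl | h
    · rw [sAt_of_length_le (length_histOf p _).le, histOf_snd]
    · rw [← ih (by omega)]
      change (if (histOf p n).1.length + 1 ≤ T then _ else _) = _
      rw [if_neg (by rw [length_histOf]; omega), sAt, histOf_snd]

theorem histOf_congr {p p' : G.Play} {n : ℕ} (h : ∀ k ≤ n, p k = p' k) :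
    histOf p n = histOf p' n := by
  induction n with
  | zero => simp [histOf, h 0]
  | succ n ih =>
    simp only [histOf]
    rw [ih fun k hk => h k (by omega), h n (by omega), h (n + 1) le_rfl]

theorem exists_eq_comp_restrict {β : Type*} {ψ : G.Play → β} (n : ℕ)
    (h : ∀ p p' : G.Play, (∀ k ≤ n, p k = p' k) → ψ p = ψ p') :
    ∃ F : (Fin (n + 1) → G.Step) → β, ∀ p, ψ p = F fun k => p k := by
  refine ⟨fun r => ψ fun k => if hk : k < n + 1 then r ⟨k, hk⟩ else r 0, fun p => h _ _ ?_⟩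
  intro k hk
  rw [dif_pos (by omega)]

theorem measurable_of_finite_dep {β : Type*} [MeasurableSpace β] {ψ : G.Play → β} (n : ℕ)
    (h : ∀ p p' : G.Play, (∀ k ≤ n, p k = p' k) → ψ p = ψ p') : Measurable ψ := by
  obtain ⟨F, hF⟩ := exists_eq_comp_restrict n h
  rw [funext hF]
  have : DiscreteMeasurableSpace G.Step := ⟨fun _ => trivial⟩
  exact (Measurable.of_discrete (f := F)).comp
    (measurable_pi_lambda _ fun k => measurable_pi_apply _)

theorem integrable_of_finite_dep {μ : Measure G.Play} [IsProbabilityMeasure μ]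
    {ψ : G.Play → ℝ} (n : ℕ)
    (h : ∀ p p' : G.Play, (∀ k ≤ n, p k = p' k) → ψ p = ψ p') : Integrable ψ μ := by
  have hm := measurable_of_finite_dep n h
  obtain ⟨F, hF⟩ := exists_eq_comp_restrict n h
  refine Integrable.of_bound hm.aestronglyMeasurable (∑ r, |F r|)
    (Eventually.of_forall fun p => ?_)
  rw [hF, Real.norm_eq_abs]
  exact Finset.single_le_sum (f := fun r => |F r|) (fun _ _ => abs_nonneg _) (Finset.mem_univ _)

theorem measurableSet_of_finite_dep {W : Set G.Play} (n : ℕ)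
    (h : ∀ p p' : G.Play, (∀ k ≤ n, p k = p' k) → p ∈ W → p' ∈ W) : MeasurableSet W := by
  have : Measurable fun p => p ∈ W := measurable_of_finite_dep n fun p p' hp =>
    propext ⟨h p p' hp, h p' p fun k hk => (hp k hk).symm⟩
  exact measurableSet_setOfPred.2 this

theorem integral_histOf {μfam : G.S → G.Profile → Measure G.Play} (hind : IsInduced μfam)
    (s0 : G.S) (σ : G.Profile) (n : ℕ) (φ : G.Hist → ℝ) :
    ∫ p, φ (histOf p n) ∂(μfam s0 σ) = histE s0 σ n φ := by
  have := hind.1 s0 σ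
  have h1 : ∀ p, φ (histOf p n) =
      ∑ h ∈ histN G n, (cylSet h).indicator (fun _ => φ h) p := by
    intro p
    rw [Finset.sum_eq_single_of_mem (histOf p n) (mem_histN.2 (length_histOf p n))]
    · rw [Set.indicator_of_mem]
      change histOf p _ = _
      rw [length_histOf]
    · intro h hh hne
      refine Set.indicator_of_notMem (fun hp => hne ?_) _
      rw [← mem_histN.1 hh]
      exact hp.symm
  have hmeas : ∀ h : G.Hist, MeasurableSet (cylSet h) := fun h =>
    measurableSet_of_finite_dep h.1.length fun p p' hp hm => by
      change histOf p' _ = _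
      rw [← histOf_congr hp]
      exact hm
  simp only [h1]
  rw [integral_finsetSum _ fun h _ => (integrable_const _).indicator (hmeas h), histE]
  refine Finset.sum_congr rfl fun h _ => ?_
  rw [integral_indicator_const _ (hmeas h), smul_eq_mul, measureReal_def, hind.2,
    ENNReal.toReal_ofReal (probHist_nonneg s0 σ h)]

/-- The indicator of a finite set of states. -/
def ind (L : Finset G.S) (s : G.S) : ℝ := if s ∈ L then 1 else 0

theorem ind_nonneg (L : Finset G.S) (s : G.S) : 0 ≤ ind L s := by
  unfold ind; split_ifs <;> norm_num

theorem ind_le_one (L : Finset G.S) (s : G.S) : ind L s ≤ 1 := by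
  unfold ind; split_ifs <;> norm_num

/-- The probability that the state at stage `T` lies in `L`. -/
def prIn (s0 : G.S) (σ : G.Profile) (T : ℕ) (L : Finset G.S) : ℝ :=
  histE s0 σ T fun h => ind L h.2

/-- The expected stage payoff `g` at stage `n`, on the event that the state at stage `T` lies
in `L`. -/
def payOn (s0 : G.S) (σ : G.Profile) (T : ℕ) (L : Finset G.S) (g : G.Step → ℝ) (n : ℕ) : ℝ :=
  histE s0 σ n fun h => ind L (sAt T h) * stepE σ g h

theorem integral_ind {μfam : G.S → G.Profile → Measure G.Play} (hind : IsInduced μfam)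
    (s0 : G.S) (σ : G.Profile) (T : ℕ) (L : Finset G.S) :
    ∫ p, ind L (p T).1 ∂(μfam s0 σ) = prIn s0 σ T L := by
  rw [prIn, ← integral_histOf hind]
  simp only [histOf_snd]

theorem integral_ind_mul {μfam : G.S → G.Profile → Measure G.Play} (hind : IsInduced μfam)
    (s0 : G.S) (σ : G.Profile) {T n : ℕ} (hT : T ≤ n) (L : Finset G.S) (g : G.Step → ℝ) :
    ∫ p, ind L (p T).1 * g (p n) ∂(μfam s0 σ) = payOn s0 σ T L g n := by
  have h1 : histE s0 σ (n + 1) (fun h => ind L (sAt T h) * lastStep g h) =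
      payOn s0 σ T L g n := by
    rw [histE_succ, payOn]
    refine histE_congr fun h hh => ?_
    rw [← nextE_lastStep, nextE, nextE, Finset.mul_sum]
    refine Finset.sum_congr rfl fun a _ => ?_
    simp only [Finset.mul_sum]
    refine Finset.sum_congr rfl fun s _ => ?_
    rw [sAt_snoc (hT.trans hh.ge)]
    ring
  rw [← h1, ← integral_histOf hind]
  refine integral_congr_ae (Eventually.of_forall fun p => ?_)
  change _ = ind L (sAt T (histOf p (n + 1))) * _
  rw [sAt_histOf p (hT.trans n.le_succ)]
  rfl

/-! ### Consequences of Property P' -/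

theorem isBddST_block (T K : ℕ) (L : Finset G.S) :
    IsBddST fun p : G.Play => if (p T).1 ∈ L then T + K else T := by
  refine ⟨⟨T + K, fun p => ?_⟩, fun p p' n hn hh => ?_⟩
  · dsimp only
    split_ifs <;> omega
  · have hTn : T ≤ n := by
      rw [← hn]
      dsimp only
      split_ifs <;> omega
    have : (p T).1 = (p' T).1 := by rw [← sAt_histOf p hTn, hh, sAt_histOf p' hTn]
    rw [← hn]
    dsimp only
    rw [this]

theorem SubgamePerfect.exists_payoff_ge {μfam : G.S → G.Profile → Measure G.Play}
    (hind : IsInduced μfam) {vbar : G.S → ℝ} {r : G.S → G.S → Prop} {i : G.I} {σ : G.Profile}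
    {s0 : G.S} {ε : ℝ} (hsp : SubgamePerfect μfam vbar r i σ s0 ε) :
    ∃ N0 : ℕ, ∀ τ : G.Play → ℕ, IsBddST τ → (N0 : ℝ) ≤ ∫ p, (τ p : ℝ) ∂(μfam s0 σ) →
      (vbar s0 - ε) * ∫ p, (τ p : ℝ) ∂(μfam s0 σ) ≤
        ∫ p, (∑ n ∈ Finset.range (τ p), G.u i (p n).1 (p n).2) ∂(μfam s0 σ) := by
  obtain ⟨N0, -, -, h⟩ := hsp
  refine ⟨N0, fun τ hτ hN => ?_⟩
  have := hind.1 s0 σ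
  have hcyl : μfam s0 σ (cylSet ([], s0)) = 1 := by
    rw [hind.2]
    simp [probHist, probHistAux]
  have hae : ∀ᵐ p ∂(μfam s0 σ), p ∈ cylSet (([], s0) : G.Hist) := by
    refine (prob_compl_eq_zero_iff (measurableSet_of_finite_dep 0 fun p p' hp hm => ?_)).2 hcyl
    change histOf p' 0 = _
    rw [← histOf_congr hp]
    exact hm
  have h2 := (h 0 τ hτ (fun p => zero_le) ([], s0) fun p _ => rfl).2
  simp only [Measure.restrict_eq_self_of_ae_mem hae, hcyl, List.length_nil, Nat.cast_zero,
    sub_zero, ENNReal.toReal_one, mul_one, Nat.Ico_zero_eq_range] at h2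
  exact h2 hN

theorem SubgamePerfect.exists_block_payoff_ge {μfam : G.S → G.Profile → Measure G.Play}
    (hind : IsInduced μfam) {vbar : G.S → ℝ} {r : G.S → G.S → Prop} {i : G.I} {σ : G.Profile}
    {s0 : G.S} {ε : ℝ} (hsp : SubgamePerfect μfam vbar r i σ s0 ε) (hv : |vbar s0| ≤ 1)
    (hε1 : ε ≤ 1) :
    ∃ N0 : ℕ, ∀ T K : ℕ, N0 ≤ T → ∀ L : Finset G.S,
      (vbar s0 - ε) * (K * prIn s0 σ T L) - 3 * T ≤
        ∑ n ∈ Finset.range K, payOn s0 σ T L (stagePay i) (T + n) := by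
  obtain ⟨N0, h⟩ := hsp.exists_payoff_ge hind
  refine ⟨N0, fun T K hT L => ?_⟩
  have := hind.1 s0 σ
  have hInd_int : Integrable (fun p : G.Play => ind L (p T).1) (μfam s0 σ) :=
    integrable_of_finite_dep T fun p p' hp => by rw [hp T le_rfl]
  have hτ : ∀ p : G.Play, (((if (p T).1 ∈ L then T + K else T : ℕ)) : ℝ) =
      T + K * ind L (p T).1 := by
    intro p
    unfold ind
    split_ifs <;> simp
  have e1 : ∫ p, (((if (p T).1 ∈ L then T + K else T : ℕ)) : ℝ) ∂(μfam s0 σ) =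
      T + K * prIn s0 σ T L := by
    simp only [hτ]
    rw [integral_add (integrable_const _) (hInd_int.const_mul _), integral_const_mul,
      integral_ind hind]
    simp
  have hu : ∀ p : G.Play, (∑ n ∈ Finset.range (if (p T).1 ∈ L then T + K else T),
      G.u i (p n).1 (p n).2) = ∑ n ∈ Finset.range T, stagePay i (p n) +
        ∑ n ∈ Finset.range K, ind L (p T).1 * stagePay i (p (T + n)) := by
    intro p
    unfold ind
    split_ifs
    · simp [Finset.sum_range_add, stagePay]
    · simp [stagePay]
  have i1 : ∀ n, Integrable (fun p : G.Play => stagePay i (p n)) (μfam s0 σ) := fun n =>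
    integrable_of_finite_dep n fun p p' hp => by rw [hp n le_rfl]
  have i2 : ∀ n, Integrable (fun p : G.Play => ind L (p T).1 * stagePay i (p (T + n)))
      (μfam s0 σ) := fun n =>
    integrable_of_finite_dep (T + n) fun p p' hp => by rw [hp T (by omega), hp (T + n) le_rfl]
  have e2 : ∫ p, (∑ n ∈ Finset.range (if (p T).1 ∈ L then T + K else T),
      G.u i (p n).1 (p n).2) ∂(μfam s0 σ) ≤
      T + ∑ n ∈ Finset.range K, payOn s0 σ T L (stagePay i) (T + n) := by
    simp only [hu]
    rw [integral_add (integrable_finsetSum _ fun n _ => i1 n)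
      (integrable_finsetSum _ fun n _ => i2 n), integral_finsetSum _ fun n _ => i2 n]
    simp only [integral_ind_mul hind s0 σ (Nat.le_add_right T _)]
    gcongr
    calc _ ≤ ∫ _, (T : ℝ) ∂(μfam s0 σ) := by
          refine integral_mono (integrable_finsetSum _ fun n _ => i1 n)
            (integrable_const _) fun p => ?_
          refine (Finset.sum_le_sum fun n _ =>
            (abs_le.1 (abs_stagePay_le i (p n))).2).trans ?_
          simp
      _ = T := by simp
  have hp : 0 ≤ prIn s0 σ T L := by
    rw [prIn, ← histE_const s0 σ T 0]
    exact histE_mono fun x _ => ind_nonneg L _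
  have hK : 0 ≤ K * prIn s0 σ T L := mul_nonneg (Nat.cast_nonneg K) hp
  have h3 := h _ (isBddST_block T K L)
  rw [e1] at h3
  have h4 := (h3 ((Nat.cast_le.2 hT).trans (by linarith))).trans e2
  have hT0 : (0 : ℝ) ≤ T := Nat.cast_nonneg T
  nlinarith [(abs_le.1 hv).1]

theorem IsPartitionF.sameOf_refl {Di : Finset (Finset G.S)} (hDi : IsPartitionF Di) (s : G.S) :
    sameOf Di s s := by
  obtain ⟨D, ⟨hD, hs⟩, -⟩ := hDi s
  exact ⟨D, hD, hs, hs⟩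

theorem IsPartitionF.sameOf_trans {Di : Finset (Finset G.S)} (hDi : IsPartitionF Di)
    {s t v : G.S} (h1 : sameOf Di s t) (h2 : sameOf Di t v) : sameOf Di s v := by
  obtain ⟨D, hD, hs, ht⟩ := h1
  obtain ⟨D', hD', ht', hv⟩ := h2
  obtain rfl := (hDi t).unique ⟨hD, ht⟩ ⟨hD', ht'⟩
  exact ⟨D, hD, hs, hv⟩

theorem IsPartitionF.sameOf_of_forall {Di : Finset (Finset G.S)} (hDi : IsPartitionF Di)
    {p : G.Play} {T n : ℕ} (hT : T ≤ n)
    (h : ∀ m, T ≤ m → m < n → sameOf Di (p m).1 (p (m + 1)).1) : sameOf Di (p T).1 (p n).1 := by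
  induction n, hT using Nat.le_induction with
  | base => exact hDi.sameOf_refl _
  | succ n hTn ih =>
    exact hDi.sameOf_trans (ih fun m hm hmn => h m hm (by omega)) (h n hTn (by omega))

theorem sum_range_blocks {M : Type*} [AddCommMonoid M] {T : ℕ → ℕ} (hT0 : T 0 = 0)
    (hT : Monotone T) (f : ℕ → M) (N : ℕ) :
    ∑ k ∈ Finset.range N, ∑ m ∈ Finset.Ico (T k) (T (k + 1)), f m =
      ∑ m ∈ Finset.range (T N), f m := by
  induction N with
  | zero => simp [hT0]
  | succ N ih =>
    rw [Finset.sum_range_succ, ih, ← Nat.Ico_zero_eq_range, ← Nat.Ico_zero_eq_range,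
      Finset.sum_Ico_consecutive _ (Nat.zero_le _) (hT N.le_succ)]

open Classical in
theorem exists_switch_bound {μfam : G.S → G.Profile → Measure G.Play}
    (hind : IsInduced μfam) {Di : Finset (Finset G.S)} (hDi : IsPartitionF Di) {σ : G.Profile}
    {s0 : G.S} {ε ζ : ℝ} {E : Set G.Play}
    (hE : ENNReal.ofReal (1 - ε) ≤ μfam s0 σ E)
    (hZ : ∫⁻ p in E, Zsw (sameOf Di) p ∂(μfam s0 σ) ≤ ENNReal.ofReal ζ)
    {T : ℕ → ℕ} (hT0 : T 0 = 0) (hT : Monotone T) :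
    ∃ b : ℕ → ℝ, Tendsto b atTop (𝓝 0) ∧ ∀ k n, T k ≤ n → n ≤ T (k + 1) →
      histE s0 σ n (fun h => if sameOf Di (sAt (T k) h) h.2 then 0 else 1) ≤ ε + b k := by
  set μ := μfam s0 σ
  have : IsProbabilityMeasure μ := hind.1 s0 σ
  set F := toMeasurable μ E
  have hF : MeasurableSet F := measurableSet_toMeasurable _ _
  have hμF : ENNReal.ofReal (1 - ε) ≤ μ F := by rwa [measure_toMeasurable]
  rw [← Measure.restrict_toMeasurable (measure_ne_top μ E)] at hZ
  set z : ℕ → G.Play → ℝ≥0∞ := fun n p => if sameOf Di (p n).1 (p (n + 1)).1 then 0 else 1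
  have hz : ∀ n, Measurable (z n) := fun n => measurable_of_finite_dep (n + 1) fun p p' hp => by
    simp only [z, hp n n.le_succ, hp (n + 1) le_rfl]
  set W : ℕ → Set G.Play := fun k =>
    {p | ∃ m, T k ≤ m ∧ m < T (k + 1) ∧ ¬ sameOf Di (p m).1 (p (m + 1)).1}
  have hW : ∀ k, MeasurableSet (W k) := fun k =>
    measurableSet_of_finite_dep (T (k + 1)) fun p p' hp => by
      rintro ⟨m, h1, h2, h3⟩
      refine ⟨m, h1, h2, ?_⟩
      rwa [← hp m h2.le, ← hp (m + 1) h2]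
  have hWz : ∀ k, μ (W k ∩ F) ≤
      ∑ m ∈ Finset.Ico (T k) (T (k + 1)), ∫⁻ p in F, z m p ∂μ := by
    intro k
    rw [← lintegral_finsetSum _ fun m _ => hz m, ← Measure.restrict_apply (hW k),
      ← lintegral_indicator_one (hW k)]
    refine lintegral_mono fun p => ?_
    by_cases hp : p ∈ W k
    · rw [Set.indicator_of_mem hp]
      obtain ⟨m, h1, h2, h3⟩ := hp
      refine le_trans ?_ (Finset.single_le_sum (f := fun m => z m p) (fun _ _ => zero_le)
        (Finset.mem_Ico.2 ⟨h1, h2⟩))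
      simp [z, h3]
    · rw [Set.indicator_of_notMem hp]
      exact zero_le
  have hsum : ∑' k, μ (W k ∩ F) ≤ ENNReal.ofReal ζ := by
    refine le_trans (ENNReal.tsum_le_tsum hWz) ?_
    refine ENNReal.tsum_le_of_sum_range_le fun N => ?_
    rw [sum_range_blocks hT0 hT, ← lintegral_finsetSum _ fun m _ => hz m]
    exact (lintegral_mono fun p => ENNReal.sum_le_tsum _).trans hZ
  have htend := ENNReal.tendsto_atTop_zero_of_tsum_ne_top
    (ne_top_of_le_ne_top ENNReal.ofReal_ne_top hsum)
  refine ⟨fun k => (μ (W k ∩ F)).toReal, ?_, fun k n h1 h2 => ?_⟩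
  · exact (ENNReal.tendsto_toReal ENNReal.zero_ne_top).comp htend
  · rw [← integral_histOf hind]
    have e1 : ∀ p, (if sameOf Di (sAt (T k) (histOf p n)) (histOf p n).2 then (0 : ℝ) else 1) ≤
        (W k).indicator 1 p := by
      intro p
      rw [sAt_histOf p h1, histOf_snd]
      by_cases hp : p ∈ W k
      · rw [Set.indicator_of_mem hp]
        split_ifs <;> norm_num
      · rw [Set.indicator_of_notMem hp, if_pos]
        refine hDi.sameOf_of_forall h1 fun m hm hmn => ?_
        by_contra hc
        exact hp ⟨m, hm, by omega, hc⟩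
    have e2 : ∫ p, (if sameOf Di (sAt (T k) (histOf p n)) (histOf p n).2 then (0 : ℝ) else 1) ∂μ ≤
        ∫ p, (W k).indicator 1 p ∂μ := by
      refine integral_mono (integrable_of_finite_dep n fun p p' hp => ?_)
        ((integrable_const (1 : ℝ)).indicator (hW k)) e1
      rw [histOf_congr hp]
    refine e2.trans ?_
    rw [integral_indicator_one (hW k)]
    have e3 : μ.real (W k) ≤ μ.real (W k ∩ F) + μ.real Fᶜ := by
      refine (measureReal_mono ?_).trans (measureReal_union_le _ _)
      intro p hp
      by_cases hpF : p ∈ F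
      · exact Or.inl ⟨hp, hpF⟩
      · exact Or.inr hpF
    have e4 : 1 - ε ≤ μ.real F := (ENNReal.ofReal_le_iff_le_toReal (measure_ne_top _ _)).1 hμF
    rw [probReal_compl_eq_one_sub hF] at e3
    change μ.real (W k) ≤ ε + μ.real (W k ∩ F)
    linarith

/-! ### Blocks in which the opponents play optimally in a discounted game -/

theorem histE_mono_of_pos {s0 : G.S} {σ : G.Profile} {n : ℕ} {φ ψ : G.Hist → ℝ}
    (h : ∀ x : G.Hist, x.1.length = n → 0 < probHist s0 σ x → φ x ≤ ψ x) :
    histE s0 σ n φ ≤ histE s0 σ n ψ := by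
  refine Finset.sum_le_sum fun x hx => ?_
  rcases (probHist_nonneg s0 σ x).eq_or_lt with h0 | h0
  · rw [← h0, zero_mul, zero_mul]
  · exact mul_le_mul_of_nonneg_left (h x (mem_histN.1 hx) h0) h0.le

theorem histE_sum {ι : Type*} (s : Finset ι) (s0 : G.S) (σ : G.Profile) (n : ℕ)
    (φ : ι → G.Hist → ℝ) :
    histE s0 σ n (fun h => ∑ k ∈ s, φ k h) = ∑ k ∈ s, histE s0 σ n (φ k) := by
  simp only [histE, Finset.mul_sum]
  exact Finset.sum_comm

/-- The expected value of `f` at the state of stage `n`, on the event that the state at stage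
`T` lies in `L`. -/
def valOn (s0 : G.S) (σ : G.Profile) (T : ℕ) (L : Finset G.S) (f : G.S → ℝ) (n : ℕ) : ℝ :=
  histE s0 σ n fun h => ind L (sAt T h) * f h.2

theorem histE_ind_sAt {s0 : G.S} {σ : G.Profile} {T n : ℕ} (hn : T ≤ n) (L : Finset G.S) :
    histE s0 σ n (fun h => ind L (sAt T h)) = prIn s0 σ T L := by
  induction n, hn using Nat.le_induction with
  | base => exact histE_congr fun h hh => by rw [sAt_of_length_le hh.le]
  | succ n hn ih =>
    rw [histE_succ, ← ih]
    refine histE_congr fun h hh => ?_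
    rw [← nextE_const σ (ind L (sAt T h)) h]
    simp only [nextE, sAt_snoc (hh ▸ hn)]

theorem prIn_nonneg (s0 : G.S) (σ : G.Profile) (T : ℕ) (L : Finset G.S) :
    0 ≤ prIn s0 σ T L := by
  rw [prIn, ← histE_const s0 σ T 0]
  exact histE_mono fun h _ => ind_nonneg L _

theorem histE_ind_mul_le {s0 : G.S} {σ : G.Profile} {T n : ℕ} (hn : T ≤ n) (L : Finset G.S)
    {φ ψ : G.Hist → ℝ} {e : ℝ} (h : ∀ x, φ x ≤ ψ x + e) :
    histE s0 σ n (fun x => ind L (sAt T x) * φ x) ≤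
      histE s0 σ n (fun x => ind L (sAt T x) * ψ x) + e * prIn s0 σ T L := by
  rw [← histE_ind_sAt hn L, ← histE_const_mul, ← histE_add]
  refine histE_mono fun x _ => ?_
  nlinarith [h x, ind_nonneg L (sAt T x)]

theorem abs_histE_ind_mul_le {s0 : G.S} {σ : G.Profile} {T n : ℕ} (hn : T ≤ n)
    (L : Finset G.S) {φ : G.Hist → ℝ} {C : ℝ} (h : ∀ x, |φ x| ≤ C) :
    |histE s0 σ n (fun x => ind L (sAt T x) * φ x)| ≤ C * prIn s0 σ T L := by
  rw [abs_le, ← neg_mul]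
  constructor
  · rw [← histE_ind_sAt hn L, ← histE_const_mul]
    exact histE_mono fun x _ => by
      nlinarith [(abs_le.1 (h x)).1, ind_nonneg L (sAt T x)]
  · rw [← histE_ind_sAt hn L, ← histE_const_mul]
    exact histE_mono fun x _ => by
      nlinarith [(abs_le.1 (h x)).2, ind_nonneg L (sAt T x)]

theorem IsShapley.valOn_step {i : G.I} {lam : ℝ} {g : G.Step → ℝ} {w : G.S → ℝ}
    {x : G.StatProf} (hw : IsShapley i lam g w x) (s0 : G.S) {σ : G.Profile} {T n : ℕ}
    (hn : T ≤ n) {L : Finset G.S}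
    (hσ : ∀ h : G.Hist, h.1.length = n → sAt T h ∈ L → ∀ j, j ≠ i → σ j h = x j h.2) :
    (1 - lam) * payOn s0 σ T L g n + lam * valOn s0 σ T L w (n + 1) ≤ valOn s0 σ T L w n := by
  rw [valOn, histE_succ, payOn, ← histE_const_mul, ← histE_const_mul, ← histE_add]
  refine histE_mono fun h hh => ?_
  have e : nextE σ (fun x => ind L (sAt T x) * w x.2) h =
      ind L (sAt T h) * nextE σ (fun x => w x.2) h := by
    rw [← nextE_const_mul]
    simp only [nextE, sAt_snoc (hh ▸ hn)]
  rw [e]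
  by_cases hL : sAt T h ∈ L
  · have := hw.le_value h.2 (fun j => σ j h) (hσ h hh hL)
    rw [oneShot_bell] at this
    simp only [ind, if_pos hL]
    linarith
  · simp [ind, if_neg hL]

/-- In a block of `K` stages in which the players other than `i` use the stationary strategies
`x`, up to an error `θ` player `i` cannot increase the expectation of `f`, and cannot obtain an
average payoff higher than `f` without decreasing the expectation of `f`. -/
def Steers (i : G.I) (f : G.S → ℝ) (g : G.Step → ℝ) (x : G.StatProf) (K : ℕ) (θ : ℝ) : Prop :=
  ∀ (s0 : G.S) (σ : G.Profile) (T : ℕ) (L : Finset G.S),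
    (∀ h : G.Hist, T ≤ h.1.length → h.1.length < T + K → sAt T h ∈ L →
      ∀ j, j ≠ i → σ j h = x j h.2) →
    valOn s0 σ T L f (T + K) ≤ valOn s0 σ T L f T + θ * prIn s0 σ T L ∧
    ∃ κ : ℝ, 0 ≤ κ ∧ ∑ n ∈ Finset.range K, payOn s0 σ T L g (T + n) ≤
      K * (valOn s0 σ T L f T + θ * prIn s0 σ T L) +
        κ * (valOn s0 σ T L f T - valOn s0 σ T L f (T + K))

theorem le_add_mul_of_step {X Gp : ℕ → ℝ} {η B : ℝ} {K : ℕ} (h0 : 0 ≤ η)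
    (hX : ∀ n ≤ K, |X n| ≤ B) (hG : ∀ n < K, |Gp n| ≤ B)
    (hstep : ∀ n < K, η * Gp n + (1 - η) * X (n + 1) ≤ X n) :
    ∀ n ≤ K, X n ≤ X 0 + 2 * B * η * n := by
  intro n
  induction n with
  | zero => intro _; simp
  | succ n ih =>
    intro hn
    have h1 := ih (by omega)
    have h2 := hstep n (by omega)
    have h3 : X (n + 1) - Gp n ≤ 2 * B := by
      linarith [(abs_le.1 (hX (n + 1) hn)).2, (abs_le.1 (hG n (by omega))).1]
    have h4 := mul_le_mul_of_nonneg_left h3 h0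
    push_cast
    linarith

theorem sum_le_of_step {X Gp : ℕ → ℝ} {η B : ℝ} {K : ℕ} (h0 : 0 ≤ η) (hB : 0 ≤ B)
    (hX : ∀ n ≤ K, |X n| ≤ B) (hG : ∀ n < K, |Gp n| ≤ B)
    (hstep : ∀ n < K, η * Gp n + (1 - η) * X (n + 1) ≤ X n) :
    ∀ n ≤ K, η * ∑ m ∈ Finset.range n, Gp m ≤
      X 0 - X n + η * (n * (X 0 + 2 * B * η * K)) := by
  intro n
  induction n with
  | zero => intro _; simp
  | succ n ih =>
    intro hn
    have h1 := ih (by omega)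
    have h2 := hstep n (by omega)
    have h3 := le_add_mul_of_step h0 hX hG hstep (n + 1) hn
    have h4 : ((n + 1 : ℕ) : ℝ) ≤ K := Nat.cast_le.2 hn
    have h5 : X (n + 1) ≤ X 0 + 2 * B * η * K :=
      h3.trans (by gcongr)
    have h6 := mul_le_mul_of_nonneg_left h5 h0
    rw [Finset.sum_range_succ]
    push_cast
    linarith

theorem IsShapley.steers {i : G.I} {η : ℝ} (h0 : 0 < η) (h1 : η ≤ 1) {g : G.Step → ℝ}
    {w f : G.S → ℝ} {x : G.StatProf} (hw : IsShapley i (1 - η) g w x) {C e θ : ℝ} {K : ℕ}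
    (hg : ∀ st, |g st| ≤ C) (hwf : ∀ s, |w s - f s| ≤ e)
    (hK : 0 < K) (hθ1 : 2 * e + 2 * C * η * K ≤ θ)
    (hθ2 : e + 2 * C * η * K + 2 * e / (η * K) ≤ θ) : Steers i f g x K θ := by
  intro s0 σ T L hσ
  set P := prIn s0 σ T L
  have hP : 0 ≤ P := prIn_nonneg _ _ _ _
  have hwC : ∀ s, |w s| ≤ C := hw.abs_le (by linarith) (by linarith) hg
  have hC : 0 ≤ C := (abs_nonneg _).trans (hwC s0)
  have hX : ∀ n ≤ K, |valOn s0 σ T L w (T + n)| ≤ C * P := fun n _ =>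
    abs_histE_ind_mul_le (by omega) L fun x => hwC x.2
  have hG : ∀ n < K, |payOn s0 σ T L g (T + n)| ≤ C * P := fun n _ =>
    abs_histE_ind_mul_le (by omega) L fun x => abs_stepE_le hg x
  have hstep : ∀ n < K, η * payOn s0 σ T L g (T + n) +
      (1 - η) * valOn s0 σ T L w (T + (n + 1)) ≤ valOn s0 σ T L w (T + n) := fun n hn => by
    have := hw.valOn_step s0 (T := T) (n := T + n) (by omega) (L := L) (σ := σ)
      fun h hh => hσ h (by omega) (by omega)
    rwa [sub_sub_cancel] at this
  have a1 := le_add_mul_of_step (X := fun n => valOn s0 σ T L w (T + n))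
    (Gp := fun n => payOn s0 σ T L g (T + n)) h0.le hX hG hstep K le_rfl
  have a2 := sum_le_of_step (X := fun n => valOn s0 σ T L w (T + n))
    (Gp := fun n => payOn s0 σ T L g (T + n)) h0.le (by positivity) hX hG hstep K le_rfl
  simp only [add_zero] at a1 a2
  have c1 : ∀ n, T ≤ n → valOn s0 σ T L w n ≤ valOn s0 σ T L f n + e * P := fun n hn =>
    histE_ind_mul_le hn L fun x => by linarith [(_root_.abs_le.1 (hwf x.2)).2]
  have c2 : ∀ n, T ≤ n → valOn s0 σ T L f n ≤ valOn s0 σ T L w n + e * P := fun n hn =>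
    histE_ind_mul_le hn L fun x => by linarith [(_root_.abs_le.1 (hwf x.2)).1]
  have d1 := c1 T le_rfl
  have d2 := c2 (T + K) (by omega)
  have d3 := c2 T le_rfl
  have d4 := c1 (T + K) (by omega)
  have hK' : (0 : ℝ) < K := Nat.cast_pos.2 hK
  constructor
  · have := mul_le_mul_of_nonneg_right hθ1 hP
    linarith
  · refine ⟨1 / η, by positivity, ?_⟩
    have hθ3 := mul_le_mul_of_nonneg_right hθ2 (mul_nonneg (mul_nonneg h0.le hK'.le) hP)
    have e1 : (e + 2 * C * η * K + 2 * e / (η * K)) * (η * K * P) =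
        (e + 2 * C * η * K) * (η * K * P) + 2 * e * P := by
      field_simp
    rw [e1] at hθ3
    have d5 := mul_le_mul_of_nonneg_left d1 (mul_nonneg h0.le hK'.le)
    refine le_of_mul_le_mul_left ?_ h0
    refine a2.trans ?_
    have e2 : η * (K * (valOn s0 σ T L f T + θ * P) +
        1 / η * (valOn s0 σ T L f T - valOn s0 σ T L f (T + K))) =
        η * K * (valOn s0 σ T L f T + θ * P) +
        (valOn s0 σ T L f T - valOn s0 σ T L f (T + K)) := by
      field_simp
    rw [e2]
    linarith

/-- If the opponents steer `f` and `L` is a set of states where `f` takes the smallest value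
possible after the block, then `L` is left with small probability, and the payoff in the block
cannot be much higher than this smallest value. -/
theorem Steers.survive {i : G.I} {f : G.S → ℝ} {g : G.Step → ℝ} {x : G.StatProf} {K : ℕ}
    {θ : ℝ} (hst : Steers i f g x K θ) {s0 : G.S} {σ : G.Profile} {T : ℕ} {L : Finset G.S}
    (hσ : ∀ h : G.Hist, T ≤ h.1.length → h.1.length < T + K → sAt T h ∈ L →
      ∀ j, j ≠ i → σ j h = x j h.2) {m γ : ℝ} (hγ : 0 < γ) (hL : ∀ s ∈ L, f s = m)
    (hnext : ∀ h : G.Hist, h.1.length = T + K → 0 < probHist s0 σ h →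
      h.2 ∈ L ∨ m + γ ≤ f h.2) :
    prIn s0 σ T L * (1 - θ / γ) ≤ prIn s0 σ (T + K) L ∧
      ∑ n ∈ Finset.range K, payOn s0 σ T L g (T + n) ≤ K * ((m + θ) * prIn s0 σ T L) := by
  obtain ⟨h1, κ, hκ, h2⟩ := hst s0 σ T L hσ
  set P := prIn s0 σ T L
  have e0 : valOn s0 σ T L f T = m * P := by
    change _ = m * histE s0 σ T fun h => ind L h.2
    rw [valOn, ← histE_const_mul]
    refine histE_congr fun h hh => ?_
    rw [sAt_of_length_le hh.le]
    by_cases h : h.2 ∈ L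
    · rw [hL _ h, mul_comm]
    · simp [ind, h]
  have e1 : (m + γ) * P - γ * prIn s0 σ (T + K) L ≤ valOn s0 σ T L f (T + K) := by
    have : P = histE s0 σ (T + K) fun h => ind L (sAt T h) := (histE_ind_sAt (by omega) L).symm
    rw [this, prIn, ← histE_const_mul, ← histE_const_mul, ← histE_sub]
    refine histE_mono_of_pos fun h hh hp => ?_
    have hi := ind_nonneg L (sAt T h)
    have hi1 := ind_le_one L (sAt T h)
    by_cases h' : h.2 ∈ L
    · have e : ind L h.2 = 1 := if_pos h'
      rw [hL _ h', e]
      nlinarith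
    · have e : ind L h.2 = 0 := if_neg h'
      have := (hnext h hh hp).resolve_left h'
      rw [e]
      nlinarith
  have e2 : m * P ≤ valOn s0 σ T L f (T + K) := by
    have : P = histE s0 σ (T + K) fun h => ind L (sAt T h) := (histE_ind_sAt (by omega) L).symm
    rw [this, ← histE_const_mul]
    refine histE_mono_of_pos fun h hh hp => ?_
    have hi := ind_nonneg L (sAt T h)
    have : m ≤ f h.2 := (hnext h hh hp).elim (fun h' => (hL _ h').ge) fun h' => by linarith
    nlinarith
  rw [e0] at h1 h2
  constructor
  · refine le_of_mul_le_mul_left ?_ hγ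
    have : γ * (P * (1 - θ / γ)) = γ * P - θ * P := by field_simp
    linarith
  · have := mul_nonneg hκ (sub_nonneg.2 e2)
    linarith

/-- Suitable lengths of blocks, for given discount rates `η n → 0` and errors `e n → 0`. -/
theorem exists_block_length {η e : ℕ → ℝ} (hη : ∀ n, 0 < η n) (hη0 : Tendsto η atTop (𝓝 0))
    (he0 : Tendsto e atTop (𝓝 0)) {C θ : ℝ} (hC : 1 ≤ C) (hθ : 0 < θ) (N : ℕ) :
    ∃ n K : ℕ, N ≤ K ∧ 0 < K ∧ η n ≤ 1 ∧ 2 * e n + 2 * C * η n * K ≤ θ ∧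
      e n + 2 * C * η n * K + 2 * e n / (η n * K) ≤ θ := by
  set t := θ / (8 * C)
  have ht : 0 < t := by positivity
  have htC : 2 * C * t = θ / 4 := by
    simp only [t]; field_simp; norm_num
  have q1 : ∀ᶠ n in atTop, η n < min 1 (t / (2 * (N + 1))) :=
    hη0.eventually_lt_const (lt_min one_pos (by positivity))
  have q2 : ∀ᶠ n in atTop, e n < min (θ / 8) (θ * t / 16) :=
    he0.eventually_lt_const (lt_min (by positivity) (by positivity))
  obtain ⟨n, h1, h2⟩ := (q1.and q2).exists
  obtain ⟨h1a, h1b⟩ := lt_min_iff.1 h1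
  obtain ⟨h2a, h2b⟩ := lt_min_iff.1 h2
  have hn := hη n
  have hNp : (0 : ℝ) ≤ N := Nat.cast_nonneg N
  have f1 : ((N : ℝ) + 1) * 2 ≤ t / η n := by
    rw [le_div_iff₀ hn]
    rw [lt_div_iff₀ (by positivity)] at h1b
    linarith
  have f2 : (⌊t / η n⌋₊ : ℝ) ≤ t / η n := Nat.floor_le (by positivity)
  have f3 : t / η n < ⌊t / η n⌋₊ + 1 := Nat.lt_floor_add_one _
  set K := ⌊t / η n⌋₊
  have g1 : η n * K ≤ t := by
    have := mul_le_mul_of_nonneg_left f2 hn.le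
    rwa [mul_div_cancel₀ _ hn.ne'] at this
  have g2 : t / 2 ≤ η n * K := by
    have : t / η n / 2 ≤ K := by linarith
    have := mul_le_mul_of_nonneg_left this hn.le
    rwa [mul_div_assoc', mul_div_cancel₀ _ hn.ne'] at this
  have g3 : 2 * C * η n * K ≤ θ / 4 := by
    rw [← htC]
    have := mul_le_mul_of_nonneg_left g1 (by positivity : 0 ≤ 2 * C)
    linarith
  have hKN : (N : ℝ) < K := by linarith
  have hpos : 0 < η n * K := by linarith
  refine ⟨n, K, by exact_mod_cast hKN.le, by exact_mod_cast hNp.trans_lt hKN, h1a.le,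
    by linarith, ?_⟩
  have g4 : 2 * e n / (η n * K) ≤ θ / 4 := by
    rw [div_le_iff₀ hpos]
    have := mul_le_mul_of_nonneg_left g2 hθ.le
    linarith
  linarith

/-! ### Payoffs in a block in the game with cutoffs -/

theorem stepE_affine (σ : G.Profile) (g : G.Step → ℝ) (a b : ℝ) (h : G.Hist) :
    stepE σ (fun st => a * g st + b) h = a * stepE σ g h + b := by
  simp only [stepE, mul_add, Finset.sum_add_distrib, ← Finset.sum_mul, sum_profProb, one_mul,
    Finset.mul_sum]
  congr 1
  exact Finset.sum_congr rfl fun x _ => by ring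

theorem ind_inter (L D : Finset G.S) (s : G.S) :
    ind (L ∩ D) s = if s ∈ D then ind L s else 0 := by
  by_cases h : s ∈ D <;> simp [ind, h]

theorem abs_cut_le {Di : Finset (Finset G.S)} (c : Finset G.S → ℝ) {D : Finset G.S}
    (hD : D ∈ Di) {a x : ℝ} (h0 : 0 ≤ a) (h1 : a ≤ 1) (hx : |x| ≤ 1) :
    |a * x + (1 - a) * c D| ≤ cutBound Di c := by
  have hc : |c D| ≤ ∑ D ∈ Di, |c D| :=
    Finset.single_le_sum (f := fun D => |c D|) (fun _ _ => abs_nonneg _) hD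
  have hC := one_le_cutBound Di c
  have hc' : |c D| ≤ cutBound Di c := by rw [cutBound]; linarith
  obtain ⟨x1, x2⟩ := abs_le.1 (hx.trans hC)
  obtain ⟨c1, c2⟩ := abs_le.1 hc'
  have := sub_nonneg.2 h1
  rw [abs_le]
  constructor <;> nlinarith

theorem sum_prIn_inter {Di : Finset (Finset G.S)} (hDi : IsPartitionF Di) (s0 : G.S)
    (σ : G.Profile) (T : ℕ) (L : Finset G.S) :
    ∑ D ∈ Di, prIn s0 σ T (L ∩ D) = prIn s0 σ T L := by
  simp only [prIn]
  rw [← histE_sum]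
  refine histE_congr fun h _ => ?_
  obtain ⟨D, -, -, e⟩ := hDi.exists_sum_eq h.2
  simp only [ind_inter]
  exact e fun _ => ind L h.2

open Classical in
theorem le_payOn_cutPay {Di : Finset (Finset G.S)} (hDi : IsPartitionF Di) (i : G.I)
    (c : Finset G.S → ℝ) {α : Finset G.S → ℝ} (hα : α ∈ Set.Icc (0 : Finset G.S → ℝ) 1)
    (s0 : G.S) (σ : G.Profile) {T n : ℕ} (hn : T ≤ n) (L : Finset G.S) :
    ∑ D ∈ Di, (α D * payOn s0 σ T (L ∩ D) (stagePay i) n +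
        (1 - α D) * c D * prIn s0 σ T (L ∩ D)) -
      2 * cutBound Di c *
        histE s0 σ n (fun h => if sameOf Di (sAt T h) h.2 then 0 else 1) ≤
      payOn s0 σ T L (cutPay i Di c α) n := by
  simp only [← histE_ind_sAt hn, payOn]
  simp only [← histE_const_mul, ← histE_add]
  rw [← histE_sum, ← histE_sub]
  refine histE_mono fun h _ => ?_
  obtain ⟨D, hD, hs, e⟩ := hDi.exists_sum_eq (sAt T h)
  have e1 : ∑ D ∈ Di, (α D * (ind (L ∩ D) (sAt T h) * stepE σ (stagePay i) h) +
      (1 - α D) * c D * ind (L ∩ D) (sAt T h)) =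
      ind L (sAt T h) * (α D * stepE σ (stagePay i) h + (1 - α D) * c D) := by
    rw [← e fun D => ind L (sAt T h) * (α D * stepE σ (stagePay i) h + (1 - α D) * c D)]
    refine Finset.sum_congr rfl fun D' _ => ?_
    rw [ind_inter]
    split_ifs <;> ring
  rw [e1]
  by_cases hsame : sameOf Di (sAt T h) h.2
  · obtain ⟨D', hD', h1, h2⟩ := hsame
    obtain rfl := (hDi _).unique ⟨hD, hs⟩ ⟨hD', h1⟩
    obtain ⟨D'', hD'', h3, e'⟩ := hDi.exists_sum_eq h.2
    obtain rfl := (hDi _).unique ⟨hD, h2⟩ ⟨hD'', h3⟩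
    rw [← stepE_affine, if_pos ⟨D, hD, hs, h2⟩, mul_zero, sub_zero]
    refine le_of_eq (congrArg _ (Finset.sum_congr rfl fun a _ => ?_))
    rw [cutPay, e' fun D => α D * G.u i h.2 a + (1 - α D) * c D]
    rfl
  · rw [if_neg hsame, mul_one]
    have b1 := abs_cut_le c hD (hα.1 D) (hα.2 D)
      (abs_stepE_le (σ := σ) (abs_stagePay_le i) h)
    have b2 := abs_stepE_le (σ := σ) (abs_cutPay_le hDi i c hα) h
    have i0 := ind_nonneg L (sAt T h)
    have i1 := ind_le_one L (sAt T h)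
    have d := mul_le_mul_of_nonneg_left
      (sub_le_sub ((abs_le.1 b1).2) ((abs_le.1 b2).1)) i0
    have := one_le_cutBound Di c
    nlinarith

open Classical in
theorem le_sum_payOn_cutPay {Di : Finset (Finset G.S)} (hDi : IsPartitionF Di) {i : G.I}
    {c : Finset G.S → ℝ} {α : Finset G.S → ℝ} (hα : α ∈ Set.Icc (0 : Finset G.S → ℝ) 1)
    {s0 : G.S} {σ : G.Profile} {T K : ℕ} {L : Finset G.S} {v r β : ℝ} (hr : 0 ≤ r)
    (hc : ∀ D ∈ Di, ∀ s ∈ D, s ∈ L → v ≤ c D)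
    (hpay : ∀ D ∈ Di, v * (K * prIn s0 σ T (L ∩ D)) - r ≤
      ∑ n ∈ Finset.range K, payOn s0 σ T (L ∩ D) (stagePay i) (T + n))
    (hβ : ∀ n < K,
      histE s0 σ (T + n) (fun h => if sameOf Di (sAt T h) h.2 then 0 else 1) ≤ β) :
    v * (K * prIn s0 σ T L) - r * Di.card - 2 * cutBound Di c * β * K ≤
      ∑ n ∈ Finset.range K, payOn s0 σ T L (cutPay i Di c α) (T + n) := by
  have hC : 0 ≤ 2 * cutBound Di c := by linarith [one_le_cutBound Di c]
  have h1 : ∑ n ∈ Finset.range K, (∑ D ∈ Di, (α D * payOn s0 σ T (L ∩ D) (stagePay i) (T + n) +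
        (1 - α D) * c D * prIn s0 σ T (L ∩ D)) - 2 * cutBound Di c * β) ≤
      ∑ n ∈ Finset.range K, payOn s0 σ T L (cutPay i Di c α) (T + n) := by
    refine Finset.sum_le_sum fun n hn => ?_
    refine le_trans ?_ (le_payOn_cutPay hDi i c hα s0 σ (Nat.le_add_right T n) L)
    have := mul_le_mul_of_nonneg_left (hβ n (Finset.mem_range.1 hn)) hC
    linarith
  refine le_trans ?_ h1
  rw [Finset.sum_sub_distrib, Finset.sum_comm, Finset.sum_const, Finset.card_range,
    nsmul_eq_mul, ← sum_prIn_inter hDi]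
  have h2 : ∑ D ∈ Di, (v * (K * prIn s0 σ T (L ∩ D)) - r) ≤
      ∑ D ∈ Di, ∑ n ∈ Finset.range K, (α D * payOn s0 σ T (L ∩ D) (stagePay i) (T + n) +
        (1 - α D) * c D * prIn s0 σ T (L ∩ D)) := by
    refine Finset.sum_le_sum fun D hD => ?_
    rw [Finset.sum_add_distrib, ← Finset.mul_sum, Finset.sum_const, Finset.card_range,
      nsmul_eq_mul]
    have a0 : 0 ≤ α D := hα.1 D
    have a1 : α D ≤ 1 := hα.2 D
    have hp := prIn_nonneg s0 σ T (L ∩ D)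
    have hcp : v * prIn s0 σ T (L ∩ D) ≤ c D * prIn s0 σ T (L ∩ D) := by
      by_cases hne : (L ∩ D).Nonempty
      · obtain ⟨s, hs⟩ := hne
        rw [Finset.mem_inter] at hs
        exact mul_le_mul_of_nonneg_right (hc D hD s hs.2 hs.1) hp
      · have : prIn s0 σ T (L ∩ D) = 0 := by
          rw [Finset.not_nonempty_iff_eq_empty.1 hne, prIn, ← histE_const s0 σ T 0]
          exact histE_congr fun h _ => by simp [ind]
        rw [this, mul_zero, mul_zero]
    have b1 := mul_le_mul_of_nonneg_left (hpay D hD) a0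
    have b2 := mul_le_mul_of_nonneg_left hcp
      (mul_nonneg (sub_nonneg.2 a1) (Nat.cast_nonneg (α := ℝ) K))
    have b3 := mul_le_mul_of_nonneg_right a1 hr
    linarith
  rw [Finset.sum_sub_distrib, Finset.sum_const, nsmul_eq_mul, ← Finset.mul_sum,
    ← Finset.mul_sum] at h2
  linarith

/-! ### The limit of the values of the games with cutoffs -/

theorem exists_gap (f : G.S → ℝ) : ∃ γ : ℝ, 0 < γ ∧ ∀ s t, f s < f t → f s + γ ≤ f t := by
  rcases isEmpty_or_nonempty G.S with h | h
  · exact ⟨1, one_pos, fun s => (h.false s).elim⟩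
  · obtain ⟨p, -, hp⟩ := Finset.exists_min_image (Finset.univ : Finset (G.S × G.S))
      (fun p => if f p.1 < f p.2 then f p.2 - f p.1 else 1) Finset.univ_nonempty
    refine ⟨if f p.1 < f p.2 then f p.2 - f p.1 else 1, ?_, fun s t hst => ?_⟩
    · split_ifs with h1
      · exact sub_pos.2 h1
      · exact one_pos
    · have := hp (s, t) (Finset.mem_univ _)
      simp only [if_pos hst] at this
      linarith

theorem exists_block_index {T : ℕ → ℕ} (hT : StrictMono T) :
    ∃ κ : ℕ → ℕ, ∀ k n, T k ≤ n → n < T (k + 1) → κ n = k := by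
  refine ⟨fun n => Nat.findGreatest (fun k => T k ≤ n) n, fun k n h1 h2 => ?_⟩
  refine Nat.findGreatest_eq_iff.2 ⟨(hT.id_le k).trans h1, fun _ => h1, fun m hm _ h3 => ?_⟩
  have := hT.monotone (Nat.succ_le_of_lt hm)
  simp only [Nat.succ_eq_add_one] at this
  omega

theorem half_le_of_mul_le {P : ℕ → ℝ} {k0 : ℕ} (h0 : 0 ≤ P k0)
    (h : ∀ k ≥ k0, P k * (1 - (1 / 2) ^ (k + 2)) ≤ P (k + 1)) :
    ∀ k ≥ k0, P k0 / 2 ≤ P k := by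
  have key : ∀ k ≥ k0, P k0 * (1 / 2 + (1 / 2) ^ (k + 1)) ≤ P k := by
    intro k hk
    induction k, hk using Nat.le_induction with
    | base =>
      have : ((1 : ℝ) / 2) ^ k0 ≤ 1 := pow_le_one₀ (by norm_num) (by norm_num)
      rw [pow_succ]
      nlinarith
    | succ k hk ih =>
      refine le_trans ?_ (h k hk)
      have a1 : ((1 : ℝ) / 2) ^ k ≤ 1 := pow_le_one₀ (by norm_num) (by norm_num)
      have a0 : (0 : ℝ) ≤ (1 / 2) ^ k := by positivity
      have b : (0 : ℝ) ≤ 1 - (1 / 2) ^ (k + 2) := by rw [pow_add]; linarith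
      refine le_trans ?_ (mul_le_mul_of_nonneg_right ih b)
      rw [mul_assoc]
      refine mul_le_mul_of_nonneg_left ?_ h0
      simp only [pow_succ] at *
      nlinarith
  intro k hk
  have := key k hk
  have : (0 : ℝ) ≤ (1 / 2) ^ (k + 1) := by positivity
  nlinarith

/-- The opponents can play in consecutive blocks, each much longer than all preceding ones, and
steer `f0` in the blocks that start in `B`, and `f1` in the other blocks. -/
theorem exists_steering_profile {i : G.I} {f0 f1 : G.S → ℝ} {g0 : G.Step → ℝ}
    {S : Set (G.Step → ℝ)}
    (hst : ∀ θ : ℝ, 0 < θ → ∀ N : ℕ, ∃ K : ℕ, N ≤ K ∧ 0 < K ∧ ∃ x0 x1 : G.StatProf, ∃ g ∈ S,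
      Steers i f0 g0 x0 K θ ∧ Steers i f1 g x1 K θ)
    (B : Finset G.S) {θ : ℕ → ℝ} (hθ : ∀ k, 0 < θ k) :
    ∃ (T K : ℕ → ℕ) (σ : G.Profile) (x0 x1 : ℕ → G.StatProf) (g : ℕ → G.Step → ℝ),
      T 0 = 0 ∧ StrictMono T ∧
      (∀ k, T (k + 1) = T k + K k ∧ (k + 1) * (T k + 1) ≤ K k ∧ g k ∈ S ∧
        Steers i f0 g0 (x0 k) (K k) (θ k) ∧ Steers i f1 (g k) (x1 k) (K k) (θ k)) ∧
      ∀ k (h : G.Hist), T k ≤ h.1.length → h.1.length < T k + K k → ∀ j,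
        σ j h = if sAt (T k) h ∈ B then x0 k j h.2 else x1 k j h.2 := by
  choose K hNK hK x0 x1 g hg h0 h1 using fun k N => hst (θ k) (hθ k) N
  let T : ℕ → ℕ := fun n => Nat.rec 0 (fun k t => t + K k ((k + 1) * (t + 1))) n
  let N : ℕ → ℕ := fun k => (k + 1) * (T k + 1)
  have hT : ∀ k, T (k + 1) = T k + K k (N k) := fun k => rfl
  have hmono : StrictMono T := strictMono_nat_of_lt_succ fun k => by
    rw [hT]
    exact Nat.lt_add_of_pos_right (hK _ _)
  obtain ⟨κ, hκ⟩ := exists_block_index hmono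
  refine ⟨T, fun k => K k (N k), fun j h => if sAt (T (κ h.1.length)) h ∈ B then
      x0 (κ h.1.length) (N (κ h.1.length)) j h.2
        else x1 (κ h.1.length) (N (κ h.1.length)) j h.2,
    fun k => x0 k (N k), fun k => x1 k (N k), fun k => g k (N k), rfl, hmono,
    fun k => ⟨hT k, hNK _ _, hg _ _, h0 _ _, h1 _ _⟩, fun k h ha hb j => ?_⟩
  simp only [hκ k _ ha (hb.trans_eq (hT k).symm)]

theorem prIn_pos {s0 : G.S} {σ : G.Profile} {L : Finset G.S} {h : G.Hist}
    (hp : 0 < probHist s0 σ h) (hL : h.2 ∈ L) : 0 < prIn s0 σ h.1.length L := by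
  refine Finset.sum_pos' (fun x _ => mul_nonneg (probHist_nonneg s0 σ x) (ind_nonneg L _))
    ⟨h, mem_histN.2 rfl, ?_⟩
  have e : ind L h.2 = 1 := if_pos hL
  simpa only [e, mul_one] using hp

theorem le_of_steers {μfam : G.S → G.Profile → Measure G.Play} (hind : IsInduced μfam) {i : G.I}
    {vbar w : G.S → ℝ} (hvb : ∀ s, |vbar s| ≤ 1) {Di : Finset (Finset G.S)}
    (hDi : IsPartitionF Di) (hP' : PropertyP' μfam vbar i Di) {c : Finset G.S → ℝ}
    (hc : ∀ D ∈ Di, ∀ s ∈ D, vbar s ≤ c D)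
    (hst : ∀ θ : ℝ, 0 < θ → ∀ N : ℕ, ∃ K : ℕ, N ≤ K ∧ 0 < K ∧ ∃ x0 x1 : G.StatProf,
      ∃ g ∈ cutPay i Di c '' Set.Icc 0 1,
        Steers i vbar (stagePay i) x0 K θ ∧ Steers i w g x1 K θ) (s : G.S) :
    vbar s ≤ w s := by
  classical
  by_contra! hlt
  obtain ⟨s0, -, hs0⟩ := Finset.exists_max_image Finset.univ (fun s => vbar s - w s)
    ⟨s, Finset.mem_univ s⟩
  set δ := vbar s0 - w s0 with hδ_def
  have hδ : 0 < δ := (sub_pos.2 hlt).trans_le (hs0 s (Finset.mem_univ s))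
  obtain ⟨γ0, hγ0, hgap0⟩ := exists_gap vbar
  obtain ⟨γ1, hγ1, hgap1⟩ := exists_gap w
  obtain ⟨γ, hγ, hγγ0, hγγ1, hγδ⟩ : ∃ γ : ℝ, 0 < γ ∧ γ ≤ γ0 ∧ γ ≤ γ1 ∧ γ ≤ δ :=
    ⟨min γ0 (min γ1 δ), lt_min hγ0 (lt_min hγ1 hδ), min_le_left _ _,
      (min_le_right _ _).trans (min_le_left _ _), (min_le_right _ _).trans (min_le_right _ _)⟩
  set C := cutBound Di c
  have hC : 1 ≤ C := one_le_cutBound Di c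
  set θ : ℕ → ℝ := fun k => γ * (1 / 2) ^ (k + 2) with hθ_def
  have hθpos : ∀ k, 0 < θ k := fun k => by positivity
  have hθγ : ∀ k, θ k / γ = (1 / 2) ^ (k + 2) := fun k => by
    simp only [hθ_def]; field_simp
  have hθ4 : ∀ k, θ k ≤ γ / 4 := fun k => by
    have : ((1 : ℝ) / 2) ^ k ≤ 1 := pow_le_one₀ (by norm_num) (by norm_num)
    simp only [hθ_def, pow_add]
    nlinarith
  set B : Finset G.S := Finset.univ.filter fun s => vbar s < vbar s0 with hB
  obtain ⟨T, K, σ0, x0, x1, g, hT0, hT, hblock, hσ0⟩ := exists_steering_profile hst B hθpos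
  obtain ⟨ζ, -, hζ⟩ := hP'
  obtain ⟨ε, hε, hε1, hεγ, hεδ⟩ : ∃ ε : ℝ, 0 < ε ∧ ε ≤ 1 ∧ ε ≤ γ / 4 ∧ 2 * C * ε ≤ δ / 16 := by
    refine ⟨min 1 (min (γ / 4) (δ / (32 * C))), by positivity, min_le_left _ _,
      (min_le_right _ _).trans (min_le_left _ _), ?_⟩
    calc 2 * C * min 1 (min (γ / 4) (δ / (32 * C))) ≤ 2 * C * (δ / (32 * C)) :=
          mul_le_mul_of_nonneg_left ((min_le_right _ _).trans (min_le_right _ _)) (by linarith)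
      _ = δ / 16 := by field_simp; norm_num
  obtain ⟨σi, hsp, E, hE, hZ⟩ := hζ ε hε s0 σ0
  set σ := Function.update σ0 i σi
  have hσ : ∀ k (h : G.Hist), T k ≤ h.1.length → h.1.length < T k + K k → ∀ j, j ≠ i →
      σ j h = if sAt (T k) h ∈ B then x0 k j h.2 else x1 k j h.2 := fun k h ha hb j hj => by
    rw [← hσ0 k h ha hb j]
    simp [σ, hj]
  obtain ⟨N0, hpay⟩ := hsp.exists_block_payoff_ge hind (hvb s0) hε1
  obtain ⟨b, hb0, hb⟩ := exists_switch_bound hind hDi hE hZ hT0 hT.monotone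
  -- the long-run behaviour on a set `L` that the opponents can keep
  have hkeep : ∀ (L : Finset G.S) (k0 : ℕ),
      (∀ k, prIn s0 σ (T k) L * (1 - θ k / γ) ≤ prIn s0 σ (T (k + 1)) L) →
      ∀ k ≥ k0, prIn s0 σ (T k0) L / 2 ≤ prIn s0 σ (T k) L := fun L k0 h =>
    half_le_of_mul_le (P := fun k => prIn s0 σ (T k) L) (prIn_nonneg _ _ _ _)
      fun k _ => (hθγ k) ▸ h k
  set R : Finset G.S := Finset.univ.filter fun s =>
    ∃ k, ∃ h : G.Hist, h.1.length = T k ∧ 0 < probHist s0 σ h ∧ h.2 = s with hR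
  have hmemR : ∀ k (h : G.Hist), h.1.length = T k → 0 < probHist s0 σ h → h.2 ∈ R :=
    fun k h h1 h2 => Finset.mem_filter.2 ⟨Finset.mem_univ _, k, h, h1, h2, rfl⟩
  by_cases hlow : ∃ s ∈ R, vbar s < vbar s0
  · obtain ⟨s1, hs1R, hs1⟩ := hlow
    obtain ⟨s2, hs2R, hs2⟩ := Finset.exists_min_image R vbar ⟨s1, hs1R⟩
    have hs2lt : vbar s2 < vbar s0 := (hs2 s1 hs1R).trans_lt hs1
    set L : Finset G.S := Finset.univ.filter fun s => vbar s = vbar s2 with hL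
    have hLB : ∀ s ∈ L, s ∈ B := fun s h => by
      simp only [hL, hB, Finset.mem_filter, Finset.mem_univ, true_and] at h ⊢
      rwa [h]
    have hsurv := fun k => (hblock k).2.2.2.1.survive (s0 := s0) (σ := σ) (T := T k) (L := L)
      (fun h ha hb hl j hj => by rw [hσ k h ha hb j hj, if_pos (hLB _ hl)]) hγ
      (m := vbar s2) (fun s h => (Finset.mem_filter.1 h).2) fun h hh hp => by
        have hm := hs2 _ (hmemR (k + 1) h (hh.trans (hblock k).1.symm) hp)
        rcases hm.eq_or_lt with h' | h'
        · exact Or.inl (Finset.mem_filter.2 ⟨Finset.mem_univ _, h'.symm⟩)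
        · exact Or.inr (by linarith [hgap0 _ _ h'])
    obtain ⟨k0, h0, h0len, h0p, h02⟩ := (Finset.mem_filter.1 hs2R).2
    have hp0 : 0 < prIn s0 σ (T k0) L := by
      rw [← h0len]
      exact prIn_pos h0p (Finset.mem_filter.2 ⟨Finset.mem_univ _, by rw [h02]⟩)
    have hk := hkeep L k0 fun k => (hblock k).1 ▸ (hsurv k).1
    obtain ⟨n, hn⟩ := exists_nat_gt (6 / (γ * (prIn s0 σ (T k0) L / 2)))
    set k := max n (max k0 N0)
    have hkn : (n : ℝ) ≤ k := Nat.cast_le.2 (le_max_left _ _)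
    have hP := hk k ((le_max_left _ _).trans (le_max_right _ _))
    have hN0 : N0 ≤ T k := ((le_max_right _ _).trans (le_max_right _ _)).trans (hT.id_le k)
    have u1 := hpay (T k) (K k) hN0 L
    have u2 := (hsurv k).2
    set P := prIn s0 σ (T k) L
    have hPpos : 0 < P := by linarith
    have hgap := hgap0 _ _ hs2lt
    have hKP : 0 ≤ K k * P := by positivity
    have u3 : K k * P * (γ / 2) ≤ 3 * T k := by
      have : K k * P * (γ / 2) ≤ K k * P * (vbar s0 - ε - (vbar s2 + θ k)) :=
        mul_le_mul_of_nonneg_left (by linarith [hθ4 k]) hKP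
      linarith
    have u4 : ((k : ℝ) + 1) * (T k + 1) ≤ K k := by exact_mod_cast (hblock k).2.1
    have u5 : ((k : ℝ) + 1) * (T k + 1) * (P * (γ / 2)) ≤ 3 * (T k + 1) := by
      have := mul_le_mul_of_nonneg_right u4 (by positivity : 0 ≤ P * (γ / 2))
      linarith
    have u6 : ((k : ℝ) + 1) * (P * γ) ≤ 6 := by
      refine le_of_mul_le_mul_right ?_ (by positivity : (0 : ℝ) < T k + 1)
      linarith
    rw [div_lt_iff₀ (by positivity)] at hn
    have u7 : (n : ℝ) * (γ * (prIn s0 σ (T k0) L / 2)) ≤ ((k : ℝ) + 1) * (P * γ) :=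
      mul_le_mul (by linarith) (by nlinarith) (by positivity) (by positivity)
    linarith
  · push Not at hlow
    set L : Finset G.S := Finset.univ.filter fun s => w s = w s0 ∧ vbar s0 ≤ vbar s with hL
    have hLB : ∀ s ∈ L, s ∉ B := fun s h => by
      simp only [hL, hB, Finset.mem_filter, Finset.mem_univ, true_and, not_lt] at h ⊢
      exact h.2
    have hsurv := fun k => (hblock k).2.2.2.2.survive (s0 := s0) (σ := σ) (T := T k) (L := L)
      (fun h ha hb hl j hj => by rw [hσ k h ha hb j hj, if_neg (hLB _ hl)]) hγ
      (m := w s0) (fun s h => (Finset.mem_filter.1 h).2.1) fun h hh hp => by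
        have hv := hlow _ (hmemR (k + 1) h (hh.trans (hblock k).1.symm) hp)
        have hm : w s0 ≤ w h.2 := by linarith [hs0 h.2 (Finset.mem_univ _)]
        rcases hm.eq_or_lt with h' | h'
        · exact Or.inl (Finset.mem_filter.2 ⟨Finset.mem_univ _, h'.symm, hv⟩)
        · exact Or.inr (by linarith [hgap1 _ _ h'])
    have hp0 : prIn s0 σ (T 0) L = 1 := by
      rw [hT0, prIn, histE_zero, ind, if_pos (by simp [hL])]
    have hk := hkeep L 0 fun k => (hblock k).1 ▸ (hsurv k).1
    have lim : Tendsto (fun k : ℕ => 3 * Di.card * (1 / ((k : ℝ) + 1)) + 2 * C * b k) atTop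
        (𝓝 (3 * Di.card * 0 + 2 * C * 0)) :=
      (tendsto_one_div_add_atTop_nhds_zero_nat.const_mul _).add (hb0.const_mul _)
    rw [mul_zero, mul_zero, add_zero] at lim
    obtain ⟨k, hk1, hk2⟩ := ((lim.eventually_lt_const (by positivity : 0 < δ / 16)).and
      (eventually_ge_atTop N0)).exists
    have hN0 : N0 ≤ T k := hk2.trans (hT.id_le k)
    have hP := hk k (Nat.zero_le k)
    rw [hp0] at hP
    have u2 := (hsurv k).2
    obtain ⟨-, hKk, ⟨α, hα, hgα⟩, -, -⟩ := hblock k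
    have u1 := le_sum_payOn_cutPay hDi hα (s0 := s0) (σ := σ) (T := T k) (K := K k) (L := L)
      (i := i) (c := c) (v := vbar s0 - ε) (r := 3 * T k) (β := ε + b k) (by positivity)
      (fun D hD s hs hl => by linarith [hc D hD s hs, (Finset.mem_filter.1 hl).2.2])
      (fun D _ => hpay (T k) (K k) hN0 (L ∩ D))
      (fun n hn => hb k (T k + n) (Nat.le_add_right _ _) (by have := (hblock k).1; omega))
    rw [hgα] at u1
    set P := prIn s0 σ (T k) L
    have u4 : ((k : ℝ) + 1) * (T k + 1) ≤ K k := by exact_mod_cast hKk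
    have hKpos : (0 : ℝ) < K k := lt_of_lt_of_le (by positivity) u4
    have u3 : (vbar s0 - ε - (w s0 + θ k)) * P ≤
        3 * Di.card * (1 / ((k : ℝ) + 1)) + 2 * C * (ε + b k) := by
      refine le_of_mul_le_mul_right ?_ hKpos
      have e1 : (T k : ℝ) ≤ 1 / ((k : ℝ) + 1) * K k := by
        rw [one_div, inv_mul_eq_div, le_div_iff₀ (by positivity)]
        linarith
      have e2 := mul_le_mul_of_nonneg_left e1 (by positivity : (0 : ℝ) ≤ 3 * Di.card)
      linarith
    have u5 : δ / 2 * (1 / 2) ≤ (vbar s0 - ε - (w s0 + θ k)) * P :=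
      mul_le_mul (by linarith [hθ4 k]) hP (by norm_num) (by linarith [hθ4 k])
    linarith

theorem eventually_mem_Ico : ∀ᶠ lam in 𝓝[<] (1 : ℝ), 0 ≤ lam ∧ lam < 1 :=
  Ico_mem_nhdsLT one_pos

theorem abs_minmaxOrig_le {lam : ℝ} (h0 : 0 ≤ lam) (h1 : lam < 1) (s : G.S) (i : G.I) :
    |minmaxOrig G lam s i| ≤ 1 := by
  obtain ⟨w, x, hw⟩ := exists_shapley i h0 h1 (stagePay i)
  rw [hw.minmaxOrig_eq h0 h1]
  exact hw.abs_le h0 h1 (abs_stagePay_le i) s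

theorem tendsto_sum_abs_sub {f : ℕ → G.S → ℝ} {f0 : G.S → ℝ}
    (h : ∀ s, Tendsto (fun n => f n s) atTop (𝓝 (f0 s))) :
    Tendsto (fun n => ∑ s, |f n s - f0 s|) atTop (𝓝 0) := by
  rw [← Finset.sum_const_zero (s := (Finset.univ : Finset G.S))]
  refine tendsto_finsetSum _ fun s _ => ?_
  have := ((h s).sub_const (f0 s)).abs
  rwa [sub_self, abs_zero] at this

theorem eventually_lt_shapley {μfam : G.S → G.Profile → Measure G.Play} (hind : IsInduced μfam)
    {i : G.I} {vbar : G.S → ℝ}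
    (hv : ∀ s, Tendsto (fun lam => minmaxOrig G lam s i) (𝓝[<] (1 : ℝ)) (𝓝 (vbar s)))
    {Di : Finset (Finset G.S)} (hDi : IsPartitionF Di) (hP' : PropertyP' μfam vbar i Di)
    {c : Finset G.S → ℝ} (hc : ∀ D ∈ Di, ∀ s ∈ D, vbar s ≤ c D) (s0 : G.S) {t : ℝ}
    (ht : t < vbar s0) :
    ∀ᶠ lam in 𝓝[<] (1 : ℝ), ∀ α ∈ Set.Icc (0 : Finset G.S → ℝ) 1, ∀ w x,
      IsShapley i lam (cutPay i Di c α) w x → t < w s0 := by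
  have hvb : ∀ s, |vbar s| ≤ 1 := fun s =>
    le_of_tendsto (hv s).abs (eventually_mem_Ico.mono fun lam h => abs_minmaxOrig_le h.1 h.2 s i)
  by_contra hcon
  obtain ⟨lam, hlam, hp⟩ := exists_seq_forall_of_frequently
    ((not_eventually.1 hcon).and_eventually eventually_mem_Ico)
  have h0 : ∀ n, 0 ≤ lam n := fun n => (hp n).2.1
  have h1 : ∀ n, lam n < 1 := fun n => (hp n).2.2
  have hp' := fun n => (hp n).1
  push Not at hp'
  choose α hα w x hw hwt using hp'
  choose v y hvy using fun n => exists_shapley i (h0 n) (h1 n) (stagePay i)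
  set C := cutBound Di c
  have hwC : ∀ n, w n ∈ Set.Icc (fun _ => -C : G.S → ℝ) (fun _ => C) := fun n =>
    ⟨fun s => (abs_le.1 ((hw n).abs_le (h0 n) (h1 n) (abs_cutPay_le hDi i c (hα n)) s)).1,
      fun s => (abs_le.1 ((hw n).abs_le (h0 n) (h1 n) (abs_cutPay_le hDi i c (hα n)) s)).2⟩
  obtain ⟨w0, -, φ, hφ, hlim⟩ := isCompact_Icc.tendsto_subseq hwC
  have hlamφ := hlam.comp hφ.tendsto_atTop
  have hwlim : ∀ s, Tendsto (fun n => w (φ n) s) atTop (𝓝 (w0 s)) := fun s =>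
    (continuous_apply s).continuousAt.tendsto.comp hlim
  have hvlim : ∀ s, Tendsto (fun n => v (φ n) s) atTop (𝓝 (vbar s)) := fun s => by
    refine ((hv s).comp hlamφ).congr fun n => ?_
    exact (hvy (φ n)).minmaxOrig_eq (h0 _) (h1 _) s
  have hηlim : Tendsto (fun n => 1 - lam (φ n)) atTop (𝓝 0) := by
    have := (tendsto_nhds_of_tendsto_nhdsWithin hlamφ).const_sub 1
    rwa [sub_self] at this
  have helim := (tendsto_sum_abs_sub hwlim).add (tendsto_sum_abs_sub hvlim)
  rw [add_zero] at helim
  have key := le_of_steers (w := w0) hind hvb hDi hP' hc (fun θ hθ N => by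
    obtain ⟨n, K, hNK, hK, hη1, e1, e2⟩ := exists_block_length
      (fun n => sub_pos.2 (h1 (φ n))) hηlim helim (one_le_cutBound Di c) hθ N
    have hle : ∀ (f f0 : G.S → ℝ) s, |f s - f0 s| ≤ ∑ s, |f s - f0 s| := fun f f0 s =>
      Finset.single_le_sum (f := fun s => |f s - f0 s|) (fun _ _ => abs_nonneg _)
        (Finset.mem_univ s)
    have hnn : ∀ f f0 : G.S → ℝ, 0 ≤ ∑ s, |f s - f0 s| := fun f f0 =>
      Finset.sum_nonneg fun _ _ => abs_nonneg _
    refine ⟨K, hNK, hK, y (φ n), x (φ n), _, ⟨α (φ n), hα _, rfl⟩, ?_, ?_⟩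
    · refine IsShapley.steers (sub_pos.2 (h1 (φ n))) hη1 (w := v (φ n))
        (by rw [sub_sub_cancel]; exact hvy _)
        (fun st => (abs_stagePay_le i st).trans (one_le_cutBound Di c)) (fun s => ?_) hK e1 e2
      exact (hle _ _ s).trans (le_add_of_nonneg_left (hnn _ _))
    · refine IsShapley.steers (sub_pos.2 (h1 (φ n))) hη1 (w := w (φ n))
        (by rw [sub_sub_cancel]; exact hw _)
        (abs_cutPay_le hDi i c (hα _)) (fun s => ?_) hK e1 e2
      exact (hle _ _ s).trans (le_add_of_nonneg_right (hnn _ _))) s0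
  have : w0 s0 ≤ t := le_of_tendsto (hwlim s0) (Eventually.of_forall fun n => hwt (φ n))
  linarith

theorem tendsto_of_le_minmaxOrig {i : G.I} {s0 : G.S} {v : ℝ} {f : ℝ → ℝ}
    (hv : Tendsto (fun lam => minmaxOrig G lam s0 i) (𝓝[<] (1 : ℝ)) (𝓝 v))
    (hle : ∀ lam, 0 ≤ lam → lam < 1 → f lam ≤ minmaxOrig G lam s0 i)
    (hge : ∀ t < v, ∀ᶠ lam in 𝓝[<] (1 : ℝ), t ≤ f lam) :
    Tendsto f (𝓝[<] (1 : ℝ)) (𝓝 v) := by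
  refine tendsto_order.2 ⟨fun a ha => ?_, fun a ha => ?_⟩
  · obtain ⟨t, h1, h2⟩ := exists_between ha
    exact (hge t h2).mono fun lam h => h1.trans_le h
  · filter_upwards [hv.eventually_lt_const ha, eventually_mem_Ico] with lam h h'
    exact (hle lam h'.1 h'.2).trans_lt h

end StocGame

end

open StocGame in
/-- under Property P' and cutoffs at least the uniform min-max value,
the min-max value in stationary strategies of the modified game and the min-max value of
the modified game have the same limit as the discount factor goes to `1`, namely the
uniform min-max value at the initial state. -/
theorem stmt_14 (G : StocGame) (μfam : G.S → G.Profile → Measure G.Play)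
    (hind : IsInduced μfam) (i : G.I) (vbar : G.S → ℝ)
    (hv : ∀ s0 : G.S,
      Tendsto (fun lam => minmaxOrig G lam s0 i) (𝓝[<] (1 : ℝ)) (𝓝 (vbar s0)))
    (Di : Finset (Finset G.S)) (hDi : IsPartitionF Di)
    (hP' : PropertyP' μfam vbar i Di)
    (c : Finset G.S → ℝ) (hc : ∀ D ∈ Di, ∀ s ∈ D, vbar s ≤ c D) (s0 : G.S) :
    Tendsto (fun lam => minmaxModStat G lam s0 i Di c) (𝓝[<] (1 : ℝ)) (𝓝 (vbar s0)) ∧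
      Tendsto (fun lam => minmaxMod G lam s0 i Di c) (𝓝[<] (1 : ℝ)) (𝓝 (vbar s0)) := by
  have hlow := fun (t : ℝ) (ht : t < vbar s0) =>
    (eventually_lt_shapley hind hv hDi hP' hc s0 ht).and eventually_mem_Ico
  constructor
  · refine tendsto_of_le_minmaxOrig (hv s0) (fun lam h0 h1 => ?_) fun t ht =>
      (hlow t ht).mono fun lam h => le_minmaxModStat_of_shapley h.2.1 h.2.2 hDi h.1
    obtain ⟨w, x, hw⟩ := exists_shapley i h0 h1 (stagePay i)
    rw [hw.minmaxOrig_eq h0 h1]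
    exact hw.minmaxModStat_le h0 h1 hDi c s0
  · refine tendsto_of_le_minmaxOrig (hv s0) (fun lam h0 h1 => ?_) fun t ht =>
      (hlow t ht).mono fun lam h => le_minmaxMod_of_shapley h.2.1 h.2.2 hDi h.1
    obtain ⟨w, x, hw⟩ := exists_shapley i h0 h1 (stagePay i)
    rw [hw.minmaxOrig_eq h0 h1]
    exact hw.minmaxMod_le h0 h1 hDi c s0
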